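/- arXiv:2402.00804 — 3 statements merged into one kernel-verified Lean document; each statement's English description precedes it below -/
import Mathlib

section
/- Let p be a prime and let G be a finite p-solvable group with O_p(G) = 1. If R is a weakly subnormal p-subgroup of G, then G = QR where Q is a special normal q-subgroup of G for some prime q ≠ p, R centralizes the Frattini subgroup Φ(Q), and R acts irreducibly on Q/Φ(Q). In particular, G is solvable and R is a Sylow p-subgroup of G. -/
/-- `H` is normal in `K` (both subgroups of an ambient group `G`). -/
def NormalIn {G : Type*} [Group G] (H K : Subgroup G) : Prop :=
  H ≤ K ∧ ∀ k ∈ K, ∀ h ∈ H, k * h * k⁻¹ ∈ H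

/-- `H` is subnormal in `K`: there is a chain `H = c 0 ⊴ c 1 ⊴ ⋯ ⊴ c n = K`. -/
def Subnormal {G : Type*} [Group G] (H K : Subgroup G) : Prop :=
  ∃ (n : ℕ) (c : Fin (n + 1) → Subgroup G),
    c 0 = H ∧ c (Fin.last n) = K ∧ ∀ i : Fin n, NormalIn (c i.castSucc) (c i.succ)

/-- `R` is weakly subnormal in `G`: not subnormal in `G`, but subnormal in every
proper subgroup of `G` containing it. -/
def WeaklySubnormal {G : Type*} [Group G] (R : Subgroup G) : Prop :=
  ¬ Subnormal R ⊤ ∧ ∀ H : Subgroup G, R ≤ H → H ≠ ⊤ → Subnormal R H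

/-- `O_p(G)`: the largest normal `p`-subgroup of `G`. -/
def pCore (p : ℕ) (G : Type*) [Group G] : Subgroup G :=
  sSup {H : Subgroup G | H.Normal ∧ IsPGroup p H}

/-- `O_{p'}(G)`: the largest normal subgroup of `G` of order coprime to `p`. -/
def pPrimeCore (p : ℕ) (G : Type*) [Group G] : Subgroup G :=
  sSup {H : Subgroup G | H.Normal ∧ Nat.Coprime (Nat.card H) p}

theorem normal_sSup {G : Type*} [Group G] {S : Set (Subgroup G)}
    (h : ∀ H ∈ S, H.Normal) : (sSup S).Normal := by
  constructor
  intro x hx g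
  have hle : sSup S ≤ (sSup S).comap ((MulAut.conj g).toMonoidHom) := by
    refine sSup_le fun H hH => fun y hy => ?_
    have : g * y * g⁻¹ ∈ H := (h H hH).conj_mem y hy g
    exact Subgroup.mem_comap.mpr (by simpa using le_sSup hH this)
  simpa using hle hx

instance pCore_normal (p : ℕ) (G : Type*) [Group G] : (pCore p G).Normal :=
  normal_sSup fun _ hH => hH.1

instance pPrimeCore_normal (p : ℕ) (G : Type*) [Group G] : (pPrimeCore p G).Normal :=
  normal_sSup fun _ hH => hH.1

/-- `Z_p^*(G)`: the preimage in `G` of the center of `G / O_{p'}(G)`. -/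
def pStarCenter (p : ℕ) (G : Type*) [Group G] : Subgroup G :=
  (Subgroup.center (G ⧸ pPrimeCore p G)).comap (QuotientGroup.mk' (pPrimeCore p G))

/-- `x` is a `p`-element: its order is a power of `p`. -/
def IsPElement (p : ℕ) {G : Type*} [Group G] (x : G) : Prop :=
  ∃ n : ℕ, orderOf x = p ^ n

/-- A finite group is `p`-solvable iff every simple section is a `p`-group
or a `p'`-group (equivalent to the usual composition-factor definition). -/
def IsPSolvable (p : ℕ) (G : Type*) [Group G] : Prop :=
  ∀ (K : Subgroup G) (H : Subgroup K) [H.Normal],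
    IsSimpleGroup (K ⧸ H) → IsPGroup p (K ⧸ H) ∨ Nat.Coprime (Nat.card (K ⧸ H)) p

/-- The Frattini subgroup of a subgroup `Q ≤ G`, as a subgroup of `G`. -/
def frattiniIn {G : Type*} [Group G] (Q : Subgroup G) : Subgroup G :=
  (frattini Q).map Q.subtype

/-- An elementary abelian `q`-group. -/
def IsElementaryAbelian (q : ℕ) (Q : Type*) [Group Q] : Prop :=
  (∀ x y : Q, x * y = y * x) ∧ ∀ x : Q, x ^ q = 1

/-- A special `q`-group: elementary abelian, or `Φ(Q) = [Q,Q] = Z(Q)`. -/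
def IsSpecial (q : ℕ) (Q : Type*) [Group Q] : Prop :=
  IsElementaryAbelian q Q ∨
    (frattini Q = commutator Q ∧ commutator Q = Subgroup.center Q)

/-- A quasisimple group: perfect, and simple modulo its center. -/
def IsQuasisimple (Q : Type*) [Group Q] : Prop :=
  commutator Q = ⊤ ∧ IsSimpleGroup (Q ⧸ Subgroup.center Q)

/-- A component of `G`: a subnormal quasisimple subgroup. -/
def IsComponent {G : Type*} [Group G] (Q : Subgroup G) : Prop :=
  Subnormal Q ⊤ ∧ IsQuasisimple Q

/-- The layer `E(G)` of `G`: the subgroup generated by the components. -/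
def layer (G : Type*) [Group G] : Subgroup G :=
  sSup {Q : Subgroup G | IsComponent Q}

/-- The Fitting subgroup `F(G)`: the largest normal nilpotent subgroup. -/
def fitting (G : Type*) [Group G] : Subgroup G :=
  sSup {H : Subgroup G | H.Normal ∧ Group.IsNilpotent H}

namespace WS

open scoped Pointwise commutatorElement

theorem coprime_comm {G : Type*} [Group G] {a b : ℕ} (hab : Nat.Coprime a b) {m r c : G}
    (hc : c = m * r * m⁻¹ * r⁻¹) (hr : r ^ a = 1) (hcb : c ^ b = 1) (hcr : c * r = r * c) :
    c = 1 := by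
  have h1 : c * r = m * r * m⁻¹ := by rw [hc]; group
  have h2 : (c * r) ^ a = 1 := by rw [h1, conj_pow, hr]; group
  have h3 : c ^ a = 1 := by
    have : Commute c r := hcr
    rw [this.mul_pow, hr, mul_one] at h2
    exact h2
  have h4 : orderOf c ∣ 1 := hab ▸ Nat.dvd_gcd (orderOf_dvd_of_pow_eq_one h3)
    (orderOf_dvd_of_pow_eq_one hcb)
  exact orderOf_eq_one_iff.mp (Nat.dvd_one.mp h4)

theorem closure_normal {G : Type*} [Group G] {S : Set G}
    (h : ∀ g : G, ∀ x ∈ S, g * x * g⁻¹ ∈ S) : (Subgroup.closure S).Normal := by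
  constructor
  intro x hx g
  have hle : Subgroup.closure S ≤ (Subgroup.closure S).comap ((MulAut.conj g).toMonoidHom) := by
    rw [Subgroup.closure_le]
    intro y hy
    exact Subgroup.subset_closure (by simpa using h g y hy)
  simpa using hle hx

theorem pow_card_sub {G : Type*} [Group G] (H : Subgroup G) {x : G} (hx : x ∈ H) :
    x ^ Nat.card H = 1 := by
  have : (⟨x, hx⟩ : H) ^ Nat.card H = 1 := pow_card_eq_one'
  exact congrArg Subtype.val this

/-- If `R` is subnormal in `H` and `M ≤ H` is an `R`-invariant `p'`-subgroup, then `R`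
centralizes `M`. -/
theorem cent_of_subnormal {G : Type*} [Group G] {R H M : Subgroup G}
    (hcop : Nat.Coprime (Nat.card R) (Nat.card M))
    (hM : ∀ r ∈ R, ∀ m ∈ M, r * m * r⁻¹ ∈ M) (hMH : M ≤ H) (hs : Subnormal R H) :
    ∀ r ∈ R, ∀ m ∈ M, r * m = m * r := by
  obtain ⟨n, c, h0, hn, hc⟩ := hs
  have hR : ∀ i : Fin (n + 1), R ≤ c i := by
    intro i
    induction i using Fin.induction with
    | zero => rw [h0]
    | succ i ih => exact ih.trans (hc i).1
  have key : ∀ i : Fin (n + 1), ∀ m ∈ M, m ∈ c i → ∀ r ∈ R, r * m = m * r := by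
    intro i
    induction i using Fin.induction with
    | zero =>
      intro m hm hmc r hr
      rw [h0] at hmc
      have h4 : orderOf m ∣ 1 := hcop ▸ Nat.dvd_gcd
        (orderOf_dvd_of_pow_eq_one (pow_card_sub R hmc))
        (orderOf_dvd_of_pow_eq_one (pow_card_sub M hm))
      rw [orderOf_eq_one_iff.mp (Nat.dvd_one.mp h4)]; simp
    | succ i ih =>
      intro m hm hmc r hr
      have hcM : m * r * m⁻¹ * r⁻¹ ∈ M := by
        have : m * (r * m⁻¹ * r⁻¹) ∈ M := M.mul_mem hm (hM r hr _ (M.inv_mem hm))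
        simpa [mul_assoc] using this
      have hcc : m * r * m⁻¹ * r⁻¹ ∈ c i.castSucc :=
        (c i.castSucc).mul_mem ((hc i).2 m hmc r (hR _ hr)) ((c i.castSucc).inv_mem (hR _ hr))
      have := coprime_comm hcop rfl (pow_card_sub R hr) (pow_card_sub M hcM)
        (ih _ hcM hcc r hr).symm
      rw [mul_inv_eq_one, mul_inv_eq_iff_eq_mul] at this
      exact this.symm
  intro r hr m hm
  exact key (Fin.last n) m hm (by rw [hn]; exact hMH hm) r hr

theorem sup_coprime {G : Type*} [Group G] [Finite G] {p : ℕ} {H K : Subgroup G} [K.Normal]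
    (hH : Nat.Coprime (Nat.card H) p) (hK : Nat.Coprime (Nat.card K) p) :
    Nat.Coprime (Nat.card (H ⊔ K : Subgroup G)) p := by
  have h : Nat.card (H ⊔ K : Subgroup G) ∣ Nat.card H * Nat.card K := by
    rw [← Subgroup.card_mul_index (K.subgroupOf (H ⊔ K))]
    have e1 : Nat.card (K.subgroupOf (H ⊔ K)) = Nat.card K :=
      Nat.card_congr (Subgroup.subgroupOfEquivOfLe le_sup_right).toEquiv
    have e2 : (K.subgroupOf (H ⊔ K)).index = (K.subgroupOf H).index := by
      exact Subgroup.relIndex_sup_right H K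
    rw [e1, e2, mul_comm]
    exact Nat.mul_dvd_mul_right (Subgroup.index_dvd_card _) _
  exact Nat.Coprime.coprime_dvd_left h (hH.mul_left hK)

theorem exists_simple_quot {D : Type*} [Group D] [Finite D] [Nontrivial D] :
    ∃ (K : Subgroup D) (_ : K.Normal), K ≠ ⊤ ∧ IsSimpleGroup (D ⧸ K) := by
  obtain ⟨K, hK⟩ := (Set.toFinite {K : Subgroup D | K.Normal ∧ K ≠ ⊤}).exists_maximal
    ⟨⊥, inferInstance, bot_ne_top⟩
  have hn : K.Normal := hK.prop.1
  refine ⟨K, hn, hK.prop.2, ?_⟩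
  have : Nontrivial (D ⧸ K) := QuotientGroup.nontrivial_iff.mpr hK.prop.2
  refine ⟨fun H hH => ?_⟩
  by_cases ht : H.comap (QuotientGroup.mk' K) = ⊤
  · right
    rw [← Subgroup.comap_top (QuotientGroup.mk' K)] at ht
    exact Subgroup.comap_injective (QuotientGroup.mk'_surjective K) ht
  · left
    have hle : K ≤ H.comap (QuotientGroup.mk' K) := by
      intro x hx
      rw [Subgroup.mem_comap, QuotientGroup.mk'_apply, (QuotientGroup.eq_one_iff x).mpr hx]
      exact H.one_mem
    have h2 := hK.le_of_ge (y := H.comap (QuotientGroup.mk' K)) ⟨inferInstance, ht⟩ hle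
    rw [eq_bot_iff]
    intro y hy
    obtain ⟨x, rfl⟩ := QuotientGroup.mk'_surjective K y
    rw [Subgroup.mem_bot]
    exact (QuotientGroup.eq_one_iff x).mpr (h2 hy)

/-- The Hall–Higman lemma 1.2.3. -/
theorem hall_higman {G : Type*} [Group G] [Finite G] {p : ℕ} (hp : p.Prime)
    (hpsolv : IsPSolvable p G)
    (hOp : ∀ H : Subgroup G, H.Normal → IsPGroup p H → H = ⊥)
    (N : Subgroup G) [N.Normal] (hN : Nat.Coprime (Nat.card N) p)
    (hmax : ∀ D : Subgroup G, D.Normal → Nat.Coprime (Nat.card D) p → D ≤ N) :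
    Subgroup.centralizer (N : Set G) ≤ N := by
  have := Fact.mk hp
  by_contra hcon
  obtain ⟨D, hD⟩ := (Set.toFinite {D : Subgroup G | D.Normal ∧
    D ≤ Subgroup.centralizer (N : Set G) ∧ ¬ D ≤ N}).exists_minimal
    ⟨_, inferInstance, le_rfl, hcon⟩
  obtain ⟨hDn, hDC, hDN⟩ := hD.prop
  have hDnt : Nontrivial D := by
    rw [Subgroup.nontrivial_iff_ne_bot]
    rintro rfl
    exact hDN bot_le
  -- `D` is not a `p'`-group
  have hpD : p ∣ Nat.card D := by
    by_contra h
    exact hDN (hmax D hDn ((Nat.Prime.coprime_iff_not_dvd hp).mpr h).symm)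
  -- the main use of minimality
  obtain ⟨K, hKn, hKt, hKs⟩ := exists_simple_quot (D := D)
  have step : ∀ P : ℕ → Prop, (∀ x : D, P (orderOf x) → x ∈ K) →
      ∀ x ∈ D, P (orderOf x) → x ∈ N := by
    intro P hP
    have hTn : (Subgroup.closure {x : G | x ∈ D ∧ P (orderOf x)}).Normal := by
      apply closure_normal
      rintro g x ⟨hx, hPx⟩
      refine ⟨hDn.conj_mem x hx g, ?_⟩
      have : orderOf (g * x * g⁻¹) = orderOf x := by
        have := orderOf_injective (MulAut.conj g).toMonoidHom (MulAut.conj g).injective x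
        simpa using this
      rw [this]; exact hPx
    have hTK : Subgroup.closure {x : G | x ∈ D ∧ P (orderOf x)} ≤ K.map D.subtype := by
      rw [Subgroup.closure_le]
      rintro x ⟨hx, hPx⟩
      exact ⟨⟨x, hx⟩, hP _ (by rwa [Subgroup.orderOf_mk]), rfl⟩
    have hTN : Subgroup.closure {x : G | x ∈ D ∧ P (orderOf x)} ≤ N := by
      by_contra hTN
      have hTD := hTK.trans (Subgroup.map_subtype_le K)
      have := hD.le_of_le ⟨hTn, hTD.trans hDC, hTN⟩ hTD
      apply hKt
      rw [eq_top_iff]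
      rintro ⟨x, hx⟩ -
      obtain ⟨y, hy, hyx⟩ := hTK (this hx)
      have : y = ⟨x, hx⟩ := Subtype.ext hyx
      rwa [← this]
    intro x hx hPx
    exact hTN (Subgroup.subset_closure ⟨hx, hPx⟩)
  rcases hpsolv D K hKs with hcase | hcase
  · -- `p`-group quotient
    have h1 := step (fun n => Nat.Coprime n p) (by
      intro x hx
      rw [← QuotientGroup.eq_one_iff]
      obtain ⟨k, hk⟩ := hcase (QuotientGroup.mk x)
      have e1 : orderOf (QuotientGroup.mk x : D ⧸ K) ∣ orderOf x :=
        orderOf_map_dvd (QuotientGroup.mk' K) x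
      have : orderOf (QuotientGroup.mk x : D ⧸ K) ∣ 1 := by
        have hc : Nat.Coprime (orderOf x) (p ^ k) := Nat.Coprime.pow_right k hx
        rw [← hc]
        exact Nat.dvd_gcd e1 (orderOf_dvd_of_pow_eq_one hk)
      exact orderOf_eq_one_iff.mp (Nat.dvd_one.mp this))
    have hq : IsPGroup p (D ⧸ N.subgroupOf D) := by
      intro y
      obtain ⟨⟨x, hx⟩, rfl⟩ := QuotientGroup.mk'_surjective _ y
      obtain ⟨k, m, hm, hkm⟩ := Nat.exists_eq_pow_mul_and_not_dvd
        (orderOf_pos x).ne' p hp.ne_one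
      refine ⟨k, ?_⟩
      rw [← map_pow]
      apply (QuotientGroup.eq_one_iff _).mpr
      rw [Subgroup.mem_subgroupOf]
      refine h1 _ (D.pow_mem hx _) ?_
      have : orderOf (x ^ p ^ k) = m := by
        rw [orderOf_pow_of_dvd (pow_ne_zero _ hp.ne_zero) (by rw [hkm]; exact dvd_mul_right _ _),
          hkm]
        exact Nat.mul_div_cancel_left _ (pow_pos hp.pos _)
      change Nat.Coprime (orderOf (x ^ p ^ k)) p
      rw [this]
      exact ((Nat.Prime.coprime_iff_not_dvd hp).mpr hm).symm
    have hDnil : Group.IsNilpotent D := by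
      have : Group.IsNilpotent (D ⧸ N.subgroupOf D) := hq.isNilpotent
      refine Subgroup.isNilpotent_of_ker_le_center (QuotientGroup.mk' (N.subgroupOf D)) ?_
      rw [QuotientGroup.ker_mk']
      rintro ⟨x, hx⟩ hxN
      rw [Subgroup.mem_center_iff]
      rintro ⟨g, hg⟩
      apply Subtype.ext
      exact ((Subgroup.mem_centralizer_iff.mp (hDC hg)) x hxN).symm
    obtain ⟨P⟩ : Nonempty (Sylow p D) := inferInstance
    have hPn : (P : Subgroup D).Normal :=
      Sylow.normal_of_normalizerCondition Group.normalizerCondition_of_isNilpotent P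
    have hPc := P.characteristic_of_normal hPn
    have := hOp ((P : Subgroup D).map D.subtype) inferInstance (P.isPGroup'.map _)
    rw [Subgroup.map_eq_bot_iff_of_injective _ D.subtype_injective] at this
    exact P.ne_bot_of_dvd_card hpD this
  · have h1 := step (fun n => n = p) (by
      intro x hx
      rw [← QuotientGroup.eq_one_iff]
      have e1 : orderOf (QuotientGroup.mk x : D ⧸ K) ∣ orderOf x :=
        orderOf_map_dvd (QuotientGroup.mk' K) x
      have : orderOf (QuotientGroup.mk x : D ⧸ K) ∣ 1 := by
        rw [← hcase]
        exact Nat.dvd_gcd (orderOf_dvd_natCard _) (hx ▸ e1)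
      exact orderOf_eq_one_iff.mp (Nat.dvd_one.mp this))
    obtain ⟨x, hx⟩ := exists_prime_orderOf_dvd_card' p hpD
    have hxN := h1 x x.2 (by rw [Subgroup.orderOf_coe]; exact hx)
    have : p ∣ Nat.card N := by
      have e := orderOf_dvd_natCard (⟨x, hxN⟩ : N)
      rw [Subgroup.orderOf_mk, Subgroup.orderOf_coe, hx] at e
      exact e
    exact hp.one_lt.ne' (Nat.dvd_one.mp (hN ▸ Nat.dvd_gcd this dvd_rfl))

/-- Existence of a maximal normal `p'`-subgroup. -/
theorem exists_pprime {G : Type*} [Group G] [Finite G] (p : ℕ) :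
    ∃ N : Subgroup G, N.Normal ∧ Nat.Coprime (Nat.card N) p ∧
    ∀ D : Subgroup G, D.Normal → Nat.Coprime (Nat.card D) p → D ≤ N := by
  obtain ⟨N, hN⟩ := (Set.toFinite {N : Subgroup G | N.Normal ∧
    Nat.Coprime (Nat.card N) p}).exists_maximal ⟨⊥, inferInstance, by simp⟩
  have hn : N.Normal := hN.prop.1
  refine ⟨N, hn, hN.prop.2, fun D hD hc => ?_⟩
  exact le_sup_left.trans (hN.le_of_ge (y := D ⊔ N)
    ⟨inferInstance, sup_coprime hc hN.prop.2⟩ le_sup_right)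

/-- If `R` does not centralize the normal `p'`-subgroup `N`, then it does not centralize some
invariant Sylow subgroup of `N`. -/
theorem exists_inv_sylow {G : Type*} [Group G] [Finite G] {p : ℕ} (hp : p.Prime)
    (R : Subgroup G) (hRp : IsPGroup p R) (N : Subgroup G) [N.Normal]
    (hN : Nat.Coprime (Nat.card N) p) (hc : ¬ N ≤ Subgroup.centralizer (R : Set G)) :
    ∃ q : ℕ, q.Prime ∧ q ≠ p ∧ ∃ M : Subgroup G, M ≤ N ∧ IsPGroup q M ∧
      (∀ r ∈ R, ∀ m ∈ M, r * m * r⁻¹ ∈ M) ∧ ¬ M ≤ Subgroup.centralizer (R : Set G) := by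
  have := Fact.mk hp
  have inv : ∀ q : ℕ, q.Prime → ∃ P : Sylow q N,
      ∀ r ∈ R, ∀ m ∈ (P : Subgroup N).map N.subtype, r * m * r⁻¹ ∈
        (P : Subgroup N).map N.subtype := by
    intro q hq
    have := Fact.mk hq
    let _ : MulAction R (Sylow q N) := MulAction.compHom _ ((MulAut.conjNormal : G →* MulAut N).comp R.subtype)
    have hnd : ¬ p ∣ Nat.card (Sylow q N) := by
      intro h
      obtain ⟨P⟩ : Nonempty (Sylow q N) := inferInstance
      have h2 : p ∣ Nat.card N :=
        h.trans (P.card_dvd_index.trans (Subgroup.index_dvd_card _))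
      exact hp.one_lt.ne' (Nat.dvd_one.mp (hN ▸ Nat.dvd_gcd h2 dvd_rfl))
    obtain ⟨P, hP⟩ := hRp.nonempty_fixed_point_of_prime_not_dvd_card (Sylow q N) hnd
    refine ⟨P, ?_⟩
    rintro r hr _ ⟨m, hm, rfl⟩
    have h1 : (MulAut.conjNormal r : MulAut N) • P = P := hP ⟨r, hr⟩
    have h2 : (MulAut.conjNormal r : MulAut N) • m ∈ (MulAut.conjNormal r : MulAut N) • P.toSubgroup :=
      Subgroup.smul_mem_pointwise_smul _ _ _ hm
    change _ ∈ (((MulAut.conjNormal r : MulAut N) • P : Sylow q N) : Subgroup N) at h2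
    rw [h1] at h2
    exact ⟨_, h2, rfl⟩
  by_contra hcon
  push Not at hcon
  apply hc
  have htop : (Subgroup.centralizer (R : Set G)).subgroupOf N = ⊤ := by
    apply Subgroup.eq_top_of_card_eq
    apply Nat.dvd_antisymm (Subgroup.card_subgroup_dvd_card _)
    rw [Nat.dvd_iff_prime_pow_dvd_dvd]
    intro q k hq hk
    have := Fact.mk hq
    by_cases hqp : q = p
    · subst hqp
      have : k = 0 := by
        by_contra hk0
        have h2 := (dvd_pow_self q hk0).trans hk
        exact hp.one_lt.ne' (Nat.dvd_one.mp (hN ▸ Nat.dvd_gcd h2 dvd_rfl))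
      simp [this]
    · obtain ⟨P, hP⟩ := inv q hq
      have h3 := hcon q hq hqp _ (Subgroup.map_subtype_le _) (P.isPGroup'.map _) hP
      have h4 : (P : Subgroup N) ≤ (Subgroup.centralizer (R : Set G)).subgroupOf N := by
        intro x hx
        exact h3 ⟨x, hx, rfl⟩
      exact (P.pow_dvd_card_of_pow_dvd_card hk).trans (Subgroup.card_dvd_of_le h4)
  rwa [Subgroup.subgroupOf_eq_top] at htop


/-- In a finite `q`-group the commutator subgroup lies in the Frattini subgroup. -/
theorem commutator_le_frattini {Q : Type*} [Group Q] [Finite Q] {q : ℕ} [Fact q.Prime]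
    (hQ : IsPGroup q Q) : commutator Q ≤ frattini Q := by
  have hnil : Group.IsNilpotent Q := hQ.isNilpotent
  rw [frattini, Order.radical]
  refine le_iInf₂ fun K hK => ?_
  have hK' : IsCoatom K := hK
  have hKn : K.Normal :=
    Subgroup.NormalizerCondition.normal_of_coatom K Group.normalizerCondition_of_isNilpotent hK'
  have : Nontrivial (Q ⧸ K) := QuotientGroup.nontrivial_iff.mpr hK'.1
  have hq : IsPGroup q (Q ⧸ K) := hQ.to_quotient K
  have hbot := hq.bot_lt_center
  have hle : K ≤ (Subgroup.center (Q ⧸ K)).comap (QuotientGroup.mk' K) := by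
    intro x hx
    rw [Subgroup.mem_comap, QuotientGroup.mk'_apply, (QuotientGroup.eq_one_iff x).mpr hx]
    exact Subgroup.one_mem _
  have htop : (Subgroup.center (Q ⧸ K)).comap (QuotientGroup.mk' K) = ⊤ := by
    rcases hle.lt_or_eq with h | h
    · exact hK'.2 _ h
    · exfalso
      apply hbot.ne'
      rw [eq_bot_iff]
      intro y hy
      obtain ⟨x, rfl⟩ := QuotientGroup.mk'_surjective K y
      rw [Subgroup.mem_bot]
      refine (QuotientGroup.eq_one_iff x).mpr ?_
      rw [h]; exact hy
  rw [commutator_def, Subgroup.commutator_le]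
  intro a _ b _
  rw [← QuotientGroup.eq_one_iff]
  have ha : a ∈ (Subgroup.center (Q ⧸ K)).comap (QuotientGroup.mk' K) := htop ▸ Subgroup.mem_top a
  have := Subgroup.mem_center_iff.mp (Subgroup.mem_comap.mp ha) (QuotientGroup.mk' K b)
  change QuotientGroup.mk' K ⁅a, b⁆ = 1
  rw [map_commutatorElement, commutatorElement_eq_one_iff_mul_comm]
  exact this.symm

theorem frattini_ne_top {Q : Type*} [Group Q] [Finite Q] [Nontrivial Q] : frattini Q ≠ ⊤ := by
  intro h
  obtain ⟨K, hK, -⟩ := (eq_top_or_exists_le_coatom (⊥ : Subgroup Q)).resolve_left bot_ne_top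
  exact hK.1 (top_le_iff.mp (h ▸ frattini_le_coatom hK))

/-- The averaging map. -/
noncomputable def avg {G : Type*} [Group G] (R Q : Subgroup G) [Q.Normal] [Fintype R] :
    Q →* Abelianization Q where
  toFun x := ∏ r : R, Abelianization.of ((MulAut.conjNormal (r : G) : MulAut Q) x)
  map_one' := by simp
  map_mul' x y := by simp [Finset.prod_mul_distrib]

theorem avg_conj {G : Type*} [Group G] (R Q : Subgroup G) [Q.Normal] [Fintype R] (s : R) (x : Q) :
    avg R Q ((MulAut.conjNormal (s : G) : MulAut Q) x) = avg R Q x := by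
  change ∏ r : R, _ = ∏ r : R, _
  refine Fintype.prod_equiv (Equiv.mulRight s) _ _ fun r => ?_
  congr 1
  simp [map_mul]

/-- An invariant subgroup of `Q` containing `[Q, R]` is all of `Q`. -/
theorem eq_of_comm {G : Type*} [Group G] (R Q : Subgroup G)
  (hcop : Nat.Coprime (Nat.card R) (Nat.card Q))
  (hcent : ∀ M : Subgroup G, M ≤ Q → (∀ r ∈ R, ∀ m ∈ M, r * m * r⁻¹ ∈ M) → M ≠ Q →
    ∀ r ∈ R, ∀ m ∈ M, r * m = m * r)
  (hnc : ¬ Q ≤ Subgroup.centralizer (R : Set G))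
    (M : Subgroup G) (hMQ : M ≤ Q) (hM : ∀ r ∈ R, ∀ m ∈ M, r * m * r⁻¹ ∈ M)
    (hc : ∀ r ∈ R, ∀ x ∈ Q, x * r * x⁻¹ * r⁻¹ ∈ M) : M = Q := by
  by_contra hne
  have h1 := hcent M hMQ hM hne
  apply hnc
  intro x hx
  rw [Subgroup.mem_centralizer_iff]
  intro r hr
  have := coprime_comm hcop rfl (pow_card_sub R hr) (pow_card_sub Q (hMQ (hc r hr x hx)))
    (h1 r hr _ (hc r hr x hx)).symm
  rw [mul_inv_eq_one, mul_inv_eq_iff_eq_mul] at this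
  exact this.symm

/-- A proper invariant subgroup of `Q` is in the commutator subgroup. -/
theorem le_commutator {G : Type*} [Group G] [Finite G] (R Q : Subgroup G) [Q.Normal]
  (hcop : Nat.Coprime (Nat.card R) (Nat.card Q))
  (hcent : ∀ M : Subgroup G, M ≤ Q → (∀ r ∈ R, ∀ m ∈ M, r * m * r⁻¹ ∈ M) → M ≠ Q →
    ∀ r ∈ R, ∀ m ∈ M, r * m = m * r)
  (hnc : ¬ Q ≤ Subgroup.centralizer (R : Set G))
    (M : Subgroup G) (hMQ : M ≤ Q) (hM : ∀ r ∈ R, ∀ m ∈ M, r * m * r⁻¹ ∈ M)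
    (hne : M ≠ Q) : M ≤ (commutator Q).map Q.subtype := by
  have := Fintype.ofFinite R
  have hker : (avg R Q).ker.map Q.subtype = Q := by
    apply eq_of_comm R Q hcop hcent hnc _ (Subgroup.map_subtype_le _)
    · rintro r hr _ ⟨x, hx, rfl⟩
      refine ⟨(MulAut.conjNormal (r : G) : MulAut Q) x, ?_, rfl⟩
      have h := avg_conj R Q ⟨r, hr⟩ x
      have hx' : avg R Q x = 1 := hx
      rw [hx'] at h
      exact h
    · intro r hr x hx
      refine ⟨⟨x, hx⟩ * (MulAut.conjNormal (r : G) : MulAut Q) ⟨x, hx⟩⁻¹, ?_, ?_⟩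
      · have h := avg_conj R Q ⟨r, hr⟩ ⟨x, hx⟩⁻¹
        change avg R Q _ = 1
        rw [map_mul]
        erw [h]
        rw [map_inv, mul_inv_cancel]
      · simp [mul_assoc]
  intro x hx
  have hxQ := hMQ hx
  have h1 : avg R Q ⟨x, hxQ⟩ = 1 := by
    have : x ∈ (avg R Q).ker.map Q.subtype := by rw [hker]; exact hxQ
    obtain ⟨y, hy, hyx⟩ := this
    have e : y = ⟨x, hxQ⟩ := Subtype.ext hyx
    rw [← e]; exact hy
  have h2 : avg R Q ⟨x, hxQ⟩ = (Abelianization.of ⟨x, hxQ⟩) ^ Nat.card R := by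
    change ∏ r : R, _ = _
    rw [Nat.card_eq_fintype_card, ← Finset.card_univ, ← Finset.prod_const]
    refine Finset.prod_congr rfl fun r _ => ?_
    congr 1
    apply Subtype.ext
    rw [MulAut.conjNormal_apply, mul_inv_eq_iff_eq_mul]
    exact hcent M hMQ hM hne r r.2 x hx
  rw [h2] at h1
  have h3 : (⟨x, hxQ⟩ : Q) ^ Nat.card Q = 1 := pow_card_eq_one'
  have h4 : orderOf (Abelianization.of (⟨x, hxQ⟩ : Q)) ∣ 1 := hcop ▸ Nat.dvd_gcd
    (orderOf_dvd_of_pow_eq_one h1)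
    (orderOf_dvd_of_pow_eq_one (by rw [← map_pow, h3, map_one]))
  have h5 := orderOf_eq_one_iff.mp (Nat.dvd_one.mp h4)
  refine ⟨⟨x, hxQ⟩, ?_, rfl⟩
  rw [← Abelianization.ker_of]
  exact h5

theorem core {G : Type*} [Group G] [Finite G] (R Q : Subgroup G) [Q.Normal]
  (hcop : Nat.Coprime (Nat.card R) (Nat.card Q))
  (hcent : ∀ M : Subgroup G, M ≤ Q → (∀ r ∈ R, ∀ m ∈ M, r * m * r⁻¹ ∈ M) → M ≠ Q →
    ∀ r ∈ R, ∀ m ∈ M, r * m = m * r)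
  (hnc : ¬ Q ≤ Subgroup.centralizer (R : Set G))
    {q : ℕ} (hq : q.Prime) (hQ : IsPGroup q Q) :
    IsSpecial q Q ∧ (∀ r ∈ R, ∀ z ∈ frattiniIn Q, r * z = z * r) ∧
      frattiniIn Q ≠ Q ∧
      (∀ N : Subgroup G, N ≤ Q → frattiniIn Q ≤ N →
        (∀ r ∈ R, ∀ n ∈ N, r * n * r⁻¹ ∈ N) → N = frattiniIn Q ∨ N = Q) := by
  have := Fact.mk hq
  have hnt : Nontrivial Q := by
    rw [Subgroup.nontrivial_iff_ne_bot]
    rintro rfl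
    exact hnc bot_le
  have conjn : ∀ M : Subgroup G, M.Normal → ∀ r ∈ R, ∀ m ∈ M, r * m * r⁻¹ ∈ M :=
    fun M hM r _ m hm => hM.conj_mem m hm r
  have mapne : ∀ K : Subgroup Q, K ≠ ⊤ → K.map Q.subtype ≠ Q := by
    intro K hK h
    apply hK
    apply Subgroup.map_injective Q.subtype_injective
    rw [h, ← MonoidHom.range_eq_map, Subgroup.range_subtype]
  have charle : ∀ K : Subgroup Q, K.Characteristic → K ≠ ⊤ → K ≤ commutator Q := by
    intro K hK hne
    have h := le_commutator R Q hcop hcent hnc (K.map Q.subtype) (Subgroup.map_subtype_le _)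
      (conjn _ inferInstance) (mapne K hne)
    exact (Subgroup.map_le_map_iff_of_injective Q.subtype_injective).mp h
  have hFn : (frattiniIn Q).Normal := by unfold frattiniIn; infer_instance
  have hFQ : frattiniIn Q ≤ Q := Subgroup.map_subtype_le _
  have hF : frattini Q = commutator Q :=
    le_antisymm (charle _ inferInstance frattini_ne_top) (commutator_le_frattini hQ)
  have hFne : frattiniIn Q ≠ Q := mapne _ frattini_ne_top
  have hRF : ∀ r ∈ R, ∀ z ∈ frattiniIn Q, r * z = z * r :=
    hcent _ hFQ (conjn _ hFn) hFne
  refine ⟨?_, hRF, hFne, ?_⟩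
  · by_cases hab : Subgroup.center Q = ⊤
    · left
      have hcomm : ∀ x y : Q, x * y = y * x := by
        intro x y
        have : y ∈ Subgroup.center Q := hab ▸ Subgroup.mem_top y
        exact Subgroup.mem_center_iff.mp this x
      refine ⟨hcomm, ?_⟩
      let f : Q →* Q := ⟨⟨fun x => x ^ q, one_pow q⟩,
        fun x y => (show Commute x y from hcomm x y).mul_pow q⟩
      have hfc : f.range.Characteristic := by
        rw [Subgroup.characteristic_iff_map_le]
        rintro φ _ ⟨_, ⟨x, rfl⟩, rfl⟩
        exact ⟨φ x, (map_pow φ x q).symm⟩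
      have hft : f.range ≠ ⊤ := by
        intro h
        have hs : Function.Surjective f := MonoidHom.range_eq_top.mp h
        have hi : Function.Injective f := Finite.injective_iff_surjective.mpr hs
        obtain ⟨x, hx⟩ := exists_prime_orderOf_dvd_card' (G := Q) q
          (hQ.card_eq_or_dvd.resolve_left Finite.one_lt_card.ne')
        have : x = 1 := hi (by
          change x ^ q = 1 ^ q
          rw [one_pow, ← hx, pow_orderOf_eq_one])
        rw [this, orderOf_one] at hx
        exact hq.one_lt.ne hx
      have hle := charle _ hfc hft
      intro x
      have h1 : x ^ q ∈ commutator Q := hle ⟨x, rfl⟩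
      have h2 : commutator Q = ⊥ := by
        rw [eq_bot_iff, commutator_def, Subgroup.commutator_le]
        intro a _ b _
        rw [Subgroup.mem_bot, commutatorElement_eq_one_iff_mul_comm]
        exact hcomm a b
      rw [h2, Subgroup.mem_bot] at h1
      exact h1
    · right
      refine ⟨hF, le_antisymm ?_ (charle _ inferInstance hab)⟩
      rw [← hF]
      have hCn : (Subgroup.centralizer (frattiniIn Q : Set G)).Normal := inferInstance
      have hRC : R ≤ Subgroup.centralizer (frattiniIn Q : Set G) := by
        intro r hr
        rw [Subgroup.mem_centralizer_iff]
        intro z hz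
        exact (hRF r hr z hz).symm
      have hQC : Subgroup.centralizer (frattiniIn Q : Set G) ⊓ Q = Q := by
        refine eq_of_comm R Q hcop hcent hnc _ inf_le_right (conjn _ inferInstance) ?_
        intro r hr x hx
        refine ⟨Subgroup.mul_mem _ (hCn.conj_mem r (hRC hr) x) (Subgroup.inv_mem _ (hRC hr)), ?_⟩
        have : x * (r * x⁻¹ * r⁻¹) ∈ Q :=
          Q.mul_mem hx ((inferInstance : Q.Normal).conj_mem _ (Q.inv_mem hx) r)
        simpa [mul_assoc] using this
      intro z hz
      rw [Subgroup.mem_center_iff]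
      rintro ⟨x, hx⟩
      apply Subtype.ext
      have hxC : x ∈ Subgroup.centralizer (frattiniIn Q : Set G) := (inf_eq_right.mp hQC) hx
      exact (Subgroup.mem_centralizer_iff.mp hxC z ⟨z, hz, rfl⟩).symm
  · intro N hNQ hFN hN
    by_cases hne : N = Q
    · exact Or.inr hne
    · left
      refine le_antisymm ?_ hFN
      have := le_commutator R Q hcop hcent hnc N hNQ hN hne
      rw [← hF] at this
      exact this

/-- Elements of `M ⊔ R` for `R` normalizing `M`. -/
theorem mem_sup_inv {G : Type*} [Group G] {M R : Subgroup G}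
    (hM : ∀ r ∈ R, ∀ m ∈ M, r * m * r⁻¹ ∈ M) {x : G} (hx : x ∈ M ⊔ R) :
    ∃ m ∈ M, ∃ r ∈ R, m * r = x := by
  have hle : R ≤ Subgroup.normalizer (M : Set G) := by
    intro r hr
    rw [Subgroup.mem_normalizer_iff]
    intro m
    refine ⟨hM r hr m, fun h => ?_⟩
    have := hM r⁻¹ (R.inv_mem hr) _ h
    simpa [mul_assoc] using this
  have h := Subgroup.coe_mul_of_right_le_normalizer_left M R hle
  have hx' : x ∈ ((M ⊔ R : Subgroup G) : Set G) := hx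
  rw [h] at hx'
  obtain ⟨m, hm, r, hr, e⟩ := hx'
  exact ⟨m, hm, r, hr, e⟩

end WS

/-- **Theorem (p-solvable case).** If `G` is a finite `p`-solvable group with `O_p(G) = 1`
and `R` is a weakly subnormal `p`-subgroup of `G`, then `G = QR` where `Q` is a special
normal `q`-subgroup for some prime `q ≠ p`, `R` centralizes `Φ(Q)`, `R` acts irreducibly
on `Q/Φ(Q)`; in particular `G` is solvable and `R` is a Sylow `p`-subgroup of `G`. -/
theorem statement0 {G : Type*} [Group G] [Finite G] {p : ℕ} (hp : p.Prime)
    (hpsolv : IsPSolvable p G) (hOp : pCore p G = ⊥)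
    (R : Subgroup G) (hRp : IsPGroup p R) (hwsn : WeaklySubnormal R) :
    (∃ q : ℕ, q.Prime ∧ q ≠ p ∧ ∃ Q : Subgroup G, Q.Normal ∧ IsPGroup q Q ∧
      IsSpecial q Q ∧ Q ⊔ R = ⊤ ∧
      (∀ r ∈ R, ∀ z ∈ frattiniIn Q, r * z = z * r) ∧
      frattiniIn Q ≠ Q ∧
      (∀ N : Subgroup G, N ≤ Q → frattiniIn Q ≤ N →
        (∀ r ∈ R, ∀ n ∈ N, r * n * r⁻¹ ∈ N) → N = frattiniIn Q ∨ N = Q)) ∧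
    IsSolvable G ∧ ∃ P : Sylow p G, (P : Subgroup G) = R := by
  
  have := Fact.mk hp
  have hOp' : ∀ H : Subgroup G, H.Normal → IsPGroup p H → H = ⊥ := by
    intro H hH hHp
    rw [eq_bot_iff, ← hOp]
    exact le_sSup ⟨hH, hHp⟩
  obtain ⟨N, hNn, hNc, hNmax⟩ := WS.exists_pprime (G := G) p
  have hHH := WS.hall_higman hp hpsolv hOp' N hNc hNmax
  obtain ⟨k, hk⟩ := IsPGroup.iff_card.mp hRp
  have hRN : ∀ x ∈ R, x ∈ N → x = 1 := by
    intro x hxR hxN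
    have hc : Nat.Coprime (Nat.card N) (Nat.card R) := hk ▸ hNc.pow_right k
    have h4 : orderOf x ∣ 1 := hc ▸ Nat.dvd_gcd
      (orderOf_dvd_of_pow_eq_one (WS.pow_card_sub N hxN))
      (orderOf_dvd_of_pow_eq_one (WS.pow_card_sub R hxR))
    exact orderOf_eq_one_iff.mp (Nat.dvd_one.mp h4)
  have hRne : R ≠ ⊥ := by
    rintro rfl
    apply hwsn.1
    refine ⟨1, ![⊥, ⊤], rfl, rfl, ?_⟩
    intro i
    fin_cases i
    refine ⟨bot_le, ?_⟩
    intro k _ h hh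
    have : h = 1 := by simpa using hh
    simp [this]
  have hnc : ¬ N ≤ Subgroup.centralizer (R : Set G) := by
    intro h
    apply hRne
    rw [eq_bot_iff]
    intro x hx
    rw [Subgroup.mem_bot]
    exact hRN x hx (hHH (Subgroup.le_centralizer_iff.mp h hx))
  obtain ⟨q, hq, hqp, Q, hQN, hQq, hQinv, hQnc⟩ := WS.exists_inv_sylow hp R hRp N hNc hnc
  have hcopM : ∀ M : Subgroup G, M ≤ N → Nat.Coprime (Nat.card R) (Nat.card M) := by
    intro M hM
    have : Nat.Coprime (Nat.card N) (Nat.card R) := hk ▸ hNc.pow_right k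
    exact (Nat.Coprime.coprime_dvd_left (Subgroup.card_dvd_of_le hM) this).symm
  have hcent : ∀ M : Subgroup G, M ≤ N → (∀ r ∈ R, ∀ m ∈ M, r * m * r⁻¹ ∈ M) → M ⊔ R ≠ ⊤ →
      ∀ r ∈ R, ∀ m ∈ M, r * m = m * r := by
    intro M hMN hM hne
    exact WS.cent_of_subnormal (hcopM M hMN) hM le_sup_left (hwsn.2 _ le_sup_right hne)
  have htop : Q ⊔ R = ⊤ := by
    by_contra hne
    apply hQnc
    intro x hx
    rw [Subgroup.mem_centralizer_iff]
    intro r hr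
    exact hcent Q hQN hQinv hne r hr x hx
  have hdec : ∀ x : G, ∃ m ∈ Q, ∃ r ∈ R, m * r = x := fun x =>
    WS.mem_sup_inv hQinv (htop ▸ Subgroup.mem_top x)
  have hQn : Q.Normal := by
    constructor
    intro x hx g
    obtain ⟨m, hm, r, hr, rfl⟩ := hdec g
    have := Q.mul_mem (Q.mul_mem hm (hQinv r hr x hx)) (Q.inv_mem hm)
    simpa [mul_assoc] using this
  have hcent' : ∀ M : Subgroup G, M ≤ Q → (∀ r ∈ R, ∀ m ∈ M, r * m * r⁻¹ ∈ M) → M ≠ Q →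
      ∀ r ∈ R, ∀ m ∈ M, r * m = m * r := by
    intro M hMQ hM hne
    refine hcent M (hMQ.trans hQN) hM fun h => hne (le_antisymm hMQ fun x hx => ?_)
    obtain ⟨m, hm, r, hr, rfl⟩ := WS.mem_sup_inv hM (h ▸ Subgroup.mem_top x)
    have hrQ : r ∈ Q := by
      have := Q.mul_mem (Q.inv_mem (hMQ hm)) hx
      simpa using this
    rw [hRN r hr (hQN hrQ), mul_one]
    exact hm
  obtain ⟨c1, c2, c3, c4⟩ := WS.core R Q (hcopM Q hQN) hcent' hQnc hq hQq
  refine ⟨⟨q, hq, hqp, Q, hQn, hQq, c1, htop, c2, c3, c4⟩, ?_, ?_⟩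
  · have := Fact.mk hq
    have : Group.IsNilpotent Q := hQq.isNilpotent
    have : Group.IsNilpotent R := hRp.isNilpotent
    have hs : Group.IsSolvable (G ⧸ Q) := by
      refine Group.isSolvable_of_surjective (f := (QuotientGroup.mk' Q).comp R.subtype) ?_
      intro y
      obtain ⟨x, rfl⟩ := QuotientGroup.mk'_surjective Q y
      obtain ⟨m, hm, r, hr, rfl⟩ := hdec x
      refine ⟨⟨r, hr⟩, ?_⟩
      have : QuotientGroup.mk' Q m = 1 := (QuotientGroup.eq_one_iff m).mpr hm
      rw [map_mul, this, one_mul]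
      rfl
    exact Group.isSolvable_of_ker_le_range Q.subtype (QuotientGroup.mk' Q) (by simp)
  · refine ⟨⟨R, hRp, ?_⟩, rfl⟩
    intro P hP hRP
    refine le_antisymm (fun x hx => ?_) hRP
    obtain ⟨m, hm, r, hr, rfl⟩ := hdec x
    have hmP : m ∈ P := by
      have := P.mul_mem hx (P.inv_mem (hRP hr))
      simpa using this
    obtain ⟨j, hj⟩ := IsPGroup.iff_card.mp hP
    have hc : Nat.Coprime (Nat.card N) (Nat.card P) := hj ▸ hNc.pow_right j
    have h4 : orderOf m ∣ 1 := hc ▸ Nat.dvd_gcd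
      (orderOf_dvd_of_pow_eq_one (WS.pow_card_sub N (hQN hm)))
      (orderOf_dvd_of_pow_eq_one (WS.pow_card_sub P hmP))
    rw [orderOf_eq_one_iff.mp (Nat.dvd_one.mp h4), one_mul]
    exact hr
end

section
/- Let G be a finite group, let p be a prime, and let x ∈ G be a p-element. Then x ∈ O_p(G) if and only if for every prime r ≠ p and every nontrivial r-element y ∈ G, r divides the order of xy. -/
section Aux
open Finset

lemma orbit_sum {X : Type*} [Fintype X] (σ : X → X) (r N m : ℕ) (hr : r.Prime)
    (hσ : ∀ x, σ^[r ^ N] x = x) (f : X → ℤ) (hf : ∀ x, f (σ x) = f x)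
    (h0 : ∀ x, σ^[r ^ m] x = x → f x = 0) :
    ((r : ℤ) ^ (m + 1)) ∣ ∑ x, f x := by
  classical
  have hN : 0 < r ^ N := pow_pos hr.pos N
  obtain ⟨M, hM⟩ : ∃ M, r ^ N = M + 1 := ⟨r ^ N - 1, by omega⟩
  let τ : Equiv.Perm X :=
    { toFun := σ
      invFun := σ^[M]
      left_inv := fun x => by
        have := hσ x
        rwa [hM, Function.iterate_succ_apply] at this
      right_inv := fun x => by
        have := hσ x
        rwa [hM, Function.iterate_succ_apply'] at this }
  have hfz : ∀ (g : Subgroup.zpowers τ) (x : X), f (g • x) = f x := by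
    rintro ⟨g, hg⟩ x
    obtain ⟨k, rfl⟩ := mem_powers_iff_mem_zpowers.2 hg
    change f ((τ ^ k) x) = f x
    clear hg
    induction k with
    | zero => rfl
    | succ k ih =>
      rw [pow_succ', Equiv.Perm.mul_apply, ← ih]
      exact hf _
  rw [Finset.sum_partition (MulAction.orbitRel (Subgroup.zpowers τ) X)]
  refine Finset.dvd_sum fun c hc => ?_
  obtain ⟨x, -, rfl⟩ := Finset.mem_image.1 hc
  have hconst : ∀ y ∈ univ.filter (fun y => (Quotient.mk (MulAction.orbitRel (Subgroup.zpowers τ) X) y) = Quotient.mk _ x), f y = f x := by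
    intro y hy
    have : y ∈ MulAction.orbit (Subgroup.zpowers τ) x := by
      have := Quotient.exact (Finset.mem_filter.1 hy).2
      exact this
    obtain ⟨g, rfl⟩ := this
    exact hfz g x
  rw [Finset.sum_congr rfl hconst, Finset.sum_const, nsmul_eq_mul]
  by_cases hx : f x = 0
  · simp [hx]
  refine Dvd.dvd.mul_right ?_ _
  have hcard : (univ.filter (fun y => (Quotient.mk (MulAction.orbitRel (Subgroup.zpowers τ) X) y) = Quotient.mk _ x)).card = Function.minimalPeriod σ x := by
    have := MulAction.minimalPeriod_eq_card τ x
    change Function.minimalPeriod σ x = _ at this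
    rw [this, Fintype.card_subtype]
    congr 1
    ext y
    simp only [Finset.mem_filter, Finset.mem_univ, true_and]
    constructor
    · intro h; exact Quotient.exact h
    · intro h; exact Quotient.sound h
  rw [hcard]
  have h1 : Function.minimalPeriod σ x ∣ r ^ N := Function.IsPeriodicPt.minimalPeriod_dvd (hσ x)
  obtain ⟨k, -, hk⟩ := (Nat.dvd_prime_pow hr).1 h1
  have h2 : ¬ Function.minimalPeriod σ x ∣ r ^ m := fun h =>
    hx (h0 x ((Function.isPeriodicPt_iff_minimalPeriod_dvd).2 h))
  rw [hk] at h2 ⊢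
  have : m + 1 ≤ k := by
    by_contra hlt
    exact h2 (pow_dvd_pow r (by omega))
  exact_mod_cast pow_dvd_pow r this

section words
set_option linter.unusedSectionVars false
variable {G : Type*} [Group G]

/-- twisted rotation -/
def twist (φ : G → G) : List G → List G
  | [] => []
  | g :: l => l ++ [φ g]

lemma twist_length (φ : G → G) (l : List G) : (twist φ l).length = l.length := by
  cases l <;> simp [twist]

lemma twist_iter (φ : G → G) (l₁ : List G) : ∀ l₂ : List G,
    (twist φ)^[l₁.length] (l₁ ++ l₂) = l₂ ++ l₁.map φ := by
  induction l₁ with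
  | nil => intro l; simp
  | cons g l ih =>
    intro l₂
    rw [List.length_cons, Function.iterate_succ_apply]
    simp only [List.cons_append, twist, List.append_assoc]
    rw [ih]; simp

lemma twist_iter_len (φ : G → G) (l : List G) :
    (twist φ)^[l.length] l = l.map φ := by
  have := twist_iter φ l []
  simpa using this

lemma twist_iter_len_mul (φ : G → G) (l : List G) (k : ℕ) :
    (twist φ)^[l.length * k] l = l.map (φ^[k]) := by
  induction k with
  | zero => simp
  | succ k ih =>
    rw [Nat.mul_succ, add_comm, Function.iterate_add_apply, ih]
    have := twist_iter_len φ (l.map φ^[k])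
    rw [List.length_map] at this
    rw [this, List.map_map]
    congr 1
    rw [Function.iterate_succ']

lemma prod_block (d k : ℕ) : ∀ l W W' : List G, l.length = d * k → W.length = d →
    l ++ W' = W ++ l → l.prod = W.prod ^ k := by
  induction k with
  | zero =>
    intro l W W' hl _ _
    have : l = [] := List.eq_nil_of_length_eq_zero (by simpa using hl)
    simp [this]
  | succ k ih =>
    intro l W W' hl hW h
    have hd : d ≤ l.length := by rw [hl]; exact Nat.le_mul_of_pos_right _ (by omega)
    have e : l = l.take d ++ l.drop d := (List.take_append_drop d l).symm
    have hlen : (l.take d).length = W.length := by simp [hW, hd]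
    have h' : l.take d ++ (l.drop d ++ W') = W ++ l := by
      rw [← List.append_assoc, ← e, h]
    obtain ⟨h1, h2⟩ := List.append_inj h' hlen
    have h3 : l.drop d ++ W' = W ++ l.drop d := by
      rw [h2]; conv_lhs => rw [e, h1]
    have := ih (l.drop d) W W' (by rw [List.length_drop, hl, Nat.mul_succ]; omega) hW h3
    conv_lhs => rw [e, h1, List.prod_append, this]
    rw [pow_succ']

lemma prod_of_fixed (φ : G → G) (d k : ℕ) (l : List G) (hl : l.length = d * (k + 1))
    (h : (twist φ)^[d] l = l) : ∃ P : G, l.prod = P ^ (k + 1) ∧ (d = 1 → l = List.replicate (k+1) P) := by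
  have hd : d ≤ l.length := by rw [hl]; exact Nat.le_mul_of_pos_right _ (by omega)
  have e : l = l.take d ++ l.drop d := (List.take_append_drop d l).symm
  have hW : (l.take d).length = d := by simp [hd]
  have := twist_iter φ (l.take d) (l.drop d)
  rw [hW, ← e, h] at this
  refine ⟨(l.take d).prod, ?_, ?_⟩
  · have h2 : l.drop d ++ (l.take d).map φ = l.take d ++ l.drop d := by rw [← this, ← e]
    have := prod_block d k _ _ _ (by rw [List.length_drop, hl, Nat.mul_succ]; omega) hW h2
    conv_lhs => rw [e, List.prod_append, this]
    rw [pow_succ']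
  · rintro rfl
    cases l with
    | nil => simp at hd
    | cons g l =>
      simp only [List.take_succ_cons, List.take_zero, List.prod_cons, List.prod_nil, mul_one]
      simp only [Function.iterate_one, twist] at h
      have hl' : l.length = k := by simpa using hl
      clear this e hW hd hl
      generalize φ g = c at h
      have : ∀ (k : ℕ) (l : List G) (a : G), l.length = k → l ++ [a] = g :: l → l = List.replicate k g := by
        intro k
        induction k with
        | zero => intro l a hl _; simpa using hl
        | succ k ih =>
          intro l a hl hh
          cases l with
          | nil => simp at hl
          | cons b l =>
            simp only [List.cons_append, List.cons.injEq] at hh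
            obtain ⟨hb, hh⟩ := hh
            rw [hb] at hh
            rw [List.replicate_succ, ← ih l a (by simpa using hl) hh, hb]
      rw [List.replicate_succ, ← this k l _ hl' h]

def vecTwist (φ : G → G) {n : ℕ} (v : List.Vector G n) : List.Vector G n :=
  ⟨twist φ v.1, by rw [twist_length]; exact v.2⟩

lemma vecTwist_iter (φ : G → G) {n : ℕ} (k : ℕ) (v : List.Vector G n) :
    ((vecTwist φ)^[k] v).1 = (twist φ)^[k] v.1 := by
  induction k with
  | zero => rfl
  | succ k ih => rw [Function.iterate_succ_apply', Function.iterate_succ_apply', ← ih]; rfl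

lemma coeff_pow_words [Fintype G] [DecidableEq G] (a : MonoidAlgebra ℤ G) (n : ℕ) : ∀ (z : G),
    (a ^ n).coeff z = ∑ v : List.Vector G n, if v.1.prod = z then (v.1.map a.coeff).prod else 0 := by
  induction n with
  | zero =>
    intro z
    rw [pow_zero, Fintype.sum_eq_single (List.Vector.nil : List.Vector G 0) (fun v hv => absurd (List.Vector.eq_nil v) hv)]
    change _ = if (([] : List G).prod = z) then (([] : List G).map a.coeff).prod else 0
    simp [MonoidAlgebra.one_def, MonoidAlgebra.coeff_single, Finsupp.single_apply]
  | succ n ih =>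
    intro z
    let e : G × List.Vector G n ≃ List.Vector G (n+1) :=
      { toFun := fun p => p.1 ::ᵥ p.2
        invFun := fun v => (v.head, v.tail)
        left_inv := fun p => by simp
        right_inv := fun v => by simp }
    rw [← e.sum_comp, Fintype.sum_prod_type]
    rw [pow_succ']
    have h1 : a = ∑ g : G, MonoidAlgebra.single g (a.coeff g) := by
      ext h
      simp [MonoidAlgebra.coeff_sum, MonoidAlgebra.coeff_single]
    conv_lhs => rw [h1, Finset.sum_mul, ← h1]
    rw [MonoidAlgebra.coeff_sum, Finsupp.finsetSum_apply]
    refine Finset.sum_congr rfl fun g _ => ?_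
    rw [MonoidAlgebra.coeff_single_mul_apply, ih, Finset.mul_sum]
    refine Finset.sum_congr rfl fun v _ => ?_
    have : (e (g, v)).1 = g :: v.1 := rfl
    rw [this, List.prod_cons, List.map_cons, List.prod_cons, mul_ite, mul_zero]
    congr 1
    rw [eq_iff_iff, eq_inv_mul_iff_mul_eq]

lemma twist_id_prod_pow (l : List G) (k : ℕ) :
    (twist id l).prod ^ k = 1 ↔ l.prod ^ k = 1 := by
  cases l with
  | nil => simp [twist]
  | cons g l =>
    have : (twist id (g :: l)).prod = g⁻¹ * (g :: l).prod * g⁻¹⁻¹ := by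
      simp [twist]
    rw [this, conj_pow, conj_eq_one_iff]

lemma twist_id_prod_one (l : List G) :
    (twist id l).prod = 1 ↔ l.prod = 1 := by
  simpa using twist_id_prod_pow l 1

lemma twist_conj_prod (u : G) (l : List G) (hu : u ≠ 1) :
    (twist (fun g => u⁻¹ * g * u) l).prod = u ↔ l.prod = u := by
  cases l with
  | nil => simp [twist]
  | cons g l =>
    simp only [twist, List.prod_append, List.prod_cons, List.prod_nil, mul_one]
    constructor
    · intro h
      have h2 : l.prod * (u⁻¹ * g) = 1 := by
        have : l.prod * (u⁻¹ * g) * u = 1 * u := by rw [one_mul]; simpa [mul_assoc] using h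
        exact mul_right_cancel this
      have h3 := eq_inv_of_mul_eq_one_left h2
      rw [h3]; group
    · intro h
      have h3 : l.prod = g⁻¹ * u := eq_inv_mul_of_mul_eq h
      rw [h3]; group

lemma twist_weight (φ : G → G) (a : G → ℤ) (ha : ∀ g, a (φ g) = a g) (l : List G) :
    ((twist φ l).map a).prod = (l.map a).prod := by
  cases l with
  | nil => simp [twist]
  | cons g l => simp [twist, ha, mul_comm]

lemma fixed_prod_one {r e n m : ℕ} (hE : ∀ (g : G) (j : ℕ), g ^ (r ^ j) = 1 → g ^ (r ^ e) = 1)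
    (hr : r.Prime) (hn : m + e ≤ n) (φ : G → G)
    (l : List G) (hl : l.length = r ^ n) (hfix : (twist φ)^[r ^ m] l = l)
    (hp : l.prod ^ (r ^ e) = 1) : l.prod = 1 := by
  obtain ⟨t, rfl⟩ := Nat.exists_eq_add_of_le hn
  obtain ⟨k, hk⟩ : ∃ k, r ^ (e + t) = k + 1 :=
    ⟨r ^ (e + t) - 1, by have := pow_pos hr.pos (e + t); omega⟩
  obtain ⟨P, hP, -⟩ := prod_of_fixed φ (r ^ m) k l (by rw [hl, ← hk, ← pow_add]; ring_nf) hfix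
  rw [← hk] at hP
  rw [hP, ← pow_mul, ← pow_add] at hp
  rw [hP, pow_add, pow_mul, hE P _ hp, one_pow]

variable [Fintype G] [DecidableEq G]

lemma coeff_sum_E {r e n m : ℕ} (hr : r.Prime)
    (hE : ∀ (g : G) (j : ℕ), g ^ (r ^ j) = 1 → g ^ (r ^ e) = 1)
    (hn : m + e ≤ n) (a : MonoidAlgebra ℤ G) :
    (r : ℤ) ^ (m + 1) ∣ ∑ u : G, if u ^ (r ^ e) = 1 ∧ u ≠ 1 then (a ^ (r ^ n)).coeff u else 0 := by
  have key := orbit_sum (X := List.Vector G (r ^ n)) (vecTwist id) r n m hr ?_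
    (fun v => if v.1.prod ^ (r ^ e) = 1 ∧ v.1.prod ≠ 1 then (v.1.map a.coeff).prod else 0) ?_ ?_
  · convert key using 1
    simp_rw [coeff_pow_words, ← Finset.sum_filter (fun u : G => u ^ (r ^ e) = 1 ∧ u ≠ 1)]
    rw [Finset.sum_comm]
    refine Finset.sum_congr rfl fun v _ => ?_
    rw [Finset.sum_ite_eq]
    simp
  · intro v
    apply Subtype.ext
    rw [vecTwist_iter]
    have := twist_iter_len id v.1
    rw [v.2] at this
    simpa using this
  · intro v
    have h1 : (vecTwist id v).1 = twist id v.1 := rfl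
    simp only [h1, twist_id_prod_pow, ne_eq, twist_id_prod_one, twist_weight id a.coeff (fun _ => rfl)]
  · intro v hv
    rw [if_neg]
    rintro ⟨h1, h2⟩
    refine h2 (fixed_prod_one hE hr hn id v.1 v.2 ?_ h1)
    rw [← vecTwist_iter, hv]

lemma coeff_conj {r e n m : ℕ} (hr : r.Prime)
    (hE : ∀ (g : G) (j : ℕ), g ^ (r ^ j) = 1 → g ^ (r ^ e) = 1)
    (hn : m + e ≤ n) (b : MonoidAlgebra ℤ G) (u : G) (hu : u ≠ 1) (hu' : u ^ (r ^ e) = 1)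
    (hb : ∀ g, b.coeff (u⁻¹ * g * u) = b.coeff g) :
    (r : ℤ) ^ (m + 1) ∣ (b ^ (r ^ n)).coeff u := by
  rw [coeff_pow_words]
  refine orbit_sum (X := List.Vector G (r ^ n)) (vecTwist (fun g => u⁻¹ * g * u)) r (n + e) m hr ?_ _ ?_ ?_
  · intro v
    apply Subtype.ext
    rw [vecTwist_iter]
    have := twist_iter_len_mul (fun g => u⁻¹ * g * u) v.1 (r ^ e)
    rw [v.2, ← pow_add] at this
    rw [this]
    have h2 : ∀ k : ℕ, (fun g => u⁻¹ * g * u)^[k] = fun g => (u ^ k)⁻¹ * g * u ^ k := by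
      intro k
      induction k with
      | zero => ext; simp
      | succ k ih =>
        rw [Function.iterate_succ', ih]; ext g
        simp [pow_succ, mul_assoc]
    rw [h2, hu']
    simp
  · intro v
    have h1 : (vecTwist (fun g => u⁻¹ * g * u) v).1 = twist (fun g => u⁻¹ * g * u) v.1 := rfl
    simp only [h1, twist_conj_prod u _ hu, twist_weight _ b.coeff hb]
  · intro v hv
    rw [if_neg]
    intro h1
    refine hu ?_
    rw [← h1]
    refine (fixed_prod_one hE hr hn (fun g => u⁻¹ * g * u) v.1 v.2 ?_ (by rw [h1, hu']))
    rw [← vecTwist_iter, hv]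

lemma coeff_one_modr {r e n : ℕ} (hr : r.Prime)
    (hE : ∀ (g : G) (j : ℕ), g ^ (r ^ j) = 1 → g ^ (r ^ e) = 1)
    (hn : e ≤ n) (a : MonoidAlgebra ℤ G) :
    (r : ℤ) ∣ (a ^ (r ^ n)).coeff 1 - ∑ u : G, if u ^ (r ^ e) = 1 then a.coeff u else 0 := by
  have key := orbit_sum (X := List.Vector G (r ^ n)) (vecTwist id) r n 0 hr ?_
    (fun v => if vecTwist id v = v then 0 else if v.1.prod = 1 then (v.1.map a.coeff).prod else 0) ?_ ?_
  · have hsplit : (a ^ (r ^ n)).coeff 1 = (∑ v : List.Vector G (r ^ n),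
        if vecTwist id v = v then 0 else if v.1.prod = 1 then (v.1.map a.coeff).prod else 0) +
        ∑ v : List.Vector G (r ^ n), if vecTwist id v = v then
          (if v.1.prod = 1 then (v.1.map a.coeff).prod else 0) else 0 := by
      rw [coeff_pow_words, ← Finset.sum_add_distrib]
      refine Finset.sum_congr rfl fun v _ => ?_
      split_ifs <;> simp
    have hfix : (∑ v : List.Vector G (r ^ n), if vecTwist id v = v then
          (if v.1.prod = 1 then (v.1.map a.coeff).prod else 0) else 0)
        = ∑ u : G, if u ^ (r ^ e) = 1 then (a.coeff u) ^ (r ^ n) else 0 := by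
      rw [← Finset.sum_filter]
      symm
      have hpos : r ^ n ≠ 0 := (pow_pos hr.pos n).ne'
      refine Finset.sum_bij (fun u _ => (⟨List.replicate (r ^ n) u, by simp⟩ : List.Vector G (r ^ n))) ?_ ?_ ?_ ?_
      · intro u _
        refine Finset.mem_filter.2 ⟨Finset.mem_univ _, ?_⟩
        apply Subtype.ext
        change twist id (List.replicate (r ^ n) u) = List.replicate (r ^ n) u
        obtain ⟨k, hk⟩ := Nat.exists_eq_succ_of_ne_zero hpos
        rw [hk, List.replicate_succ]
        simp only [twist, id]
        rw [← List.replicate_succ, List.replicate_succ']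
      · intro u _ v _ h
        have h1 := congrArg Subtype.val h
        exact List.replicate_right_injective hpos h1
      · intro v hv
        have hv' : vecTwist id v = v := by simpa using hv
        obtain ⟨k, hk⟩ := Nat.exists_eq_succ_of_ne_zero hpos
        obtain ⟨P, -, hP⟩ := prod_of_fixed id 1 k v.1 (by rw [v.2, hk]; omega) (congrArg Subtype.val hv')
        refine ⟨P, Finset.mem_univ _, ?_⟩
        apply Subtype.ext
        change List.replicate (r ^ n) P = v.1
        exact ((hP rfl).trans (by rw [hk])).symm
      · intro u _
        simp only [List.prod_replicate, List.map_replicate]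
        congr 1
        rw [eq_iff_iff]
        constructor
        · intro h
          obtain ⟨t, rfl⟩ := Nat.exists_eq_add_of_le hn
          rw [pow_add, pow_mul, h, one_pow]
        · intro h; exact hE u n h
    have hfermat : (r : ℤ) ∣ (∑ u : G, if u ^ (r ^ e) = 1 then (a.coeff u) ^ (r ^ n) else 0)
        - ∑ u : G, if u ^ (r ^ e) = 1 then a.coeff u else 0 := by
      rw [← Finset.sum_sub_distrib]
      refine Finset.dvd_sum fun u _ => ?_
      split_ifs
      · have := Fact.mk hr
        rw [← ZMod.intCast_zmod_eq_zero_iff_dvd]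
        push_cast
        rw [ZMod.pow_card_pow, sub_self]
      · simp
    rw [hsplit, hfix, add_sub_assoc]
    exact dvd_add (by simpa using key) hfermat
  · intro v
    apply Subtype.ext
    rw [vecTwist_iter]
    have := twist_iter_len id v.1
    rw [v.2] at this
    simpa using this
  · intro v
    have hinj : Function.Injective (vecTwist (G := G) id (n := r ^ n)) := by
      intro v w h
      have h1 := congrArg Subtype.val h
      obtain ⟨v, hv⟩ := v
      obtain ⟨w, hw⟩ := w
      apply Subtype.ext
      change twist id v = twist id w at h1
      change v = w
      cases v with
      | nil =>
        cases w with
        | nil => rfl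
        | cons b w => exact absurd (hv.trans hw.symm) (by simp)
      | cons c v =>
        cases w with
        | nil => exact absurd (hv.trans hw.symm) (by simp)
        | cons b w =>
          simp only [twist, id] at h1
          obtain ⟨h2, h3⟩ := List.append_inj' h1 rfl
          simp only [List.cons.injEq, and_true] at h3
          rw [h2, h3]
    have h1 : (vecTwist id v).1 = twist id v.1 := rfl
    simp only [h1, twist_id_prod_one, hinj.eq_iff, twist_weight id a.coeff (fun _ => rfl)]
  · intro v hv
    rw [if_pos]
    simpa using hv

lemma coeff_center (h : MonoidAlgebra ℤ G) (hh : h ∈ Subring.center (MonoidAlgebra ℤ G)) (k g : G) :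
    h.coeff (k⁻¹ * g * k) = h.coeff g := by
  have h1 := (Subring.mem_center_iff.1 hh) (MonoidAlgebra.single k 1)
  have h2 := congrArg (fun y => y.coeff (g * k)) h1
  simp only [MonoidAlgebra.coeff_single_mul_apply, MonoidAlgebra.coeff_mul_single_apply] at h2
  simpa [mul_assoc] using h2

lemma coeff_center' (h : MonoidAlgebra ℤ G) (hh : h ∈ Subring.center (MonoidAlgebra ℤ G)) (k g : G) :
    h.coeff (g * k) = h.coeff (k * g) := by
  have := coeff_center h hh k (k * g)
  simpa [mul_assoc] using this

lemma eq_sum_single (a : MonoidAlgebra ℤ G) : a = ∑ g : G, MonoidAlgebra.single g (a.coeff g) := by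
  ext h
  simp [MonoidAlgebra.coeff_sum, MonoidAlgebra.coeff_single]

lemma mem_center_of_coeff (h : MonoidAlgebra ℤ G)
    (hh : ∀ k g : G, h.coeff (g * k) = h.coeff (k * g)) : h ∈ Subring.center (MonoidAlgebra ℤ G) := by
  rw [Subring.mem_center_iff]
  intro y
  rw [eq_sum_single y, Finset.sum_mul, Finset.mul_sum]
  refine Finset.sum_congr rfl fun g _ => ?_
  ext k
  simp only [MonoidAlgebra.coeff_single_mul_apply, MonoidAlgebra.coeff_mul_single_apply]
  rw [hh, mul_comm]

lemma pow_single_mul (h : MonoidAlgebra ℤ G) (hh : h ∈ Subring.center (MonoidAlgebra ℤ G)) (k : G) (q : ℕ) :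
    (MonoidAlgebra.single k 1 * h) ^ q = MonoidAlgebra.single (k ^ q) 1 * h ^ q := by
  have hc : Commute (MonoidAlgebra.single k (1 : ℤ)) h := (Subring.mem_center_iff.1 hh) _
  rw [hc.mul_pow, MonoidAlgebra.single_pow, one_pow]

lemma coeff_nonreg {r e n m : ℕ} (hr : r.Prime)
    (hE : ∀ (g : G) (j : ℕ), g ^ (r ^ j) = 1 → g ^ (r ^ e) = 1)
    (hReg : ∀ g : G, ¬ r ∣ orderOf (g ^ (r ^ e)))
    (hR : ∀ z : G, ¬ r ∣ orderOf z → z ^ (r ^ n) = z)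
    (hn : m + e ≤ n) (h : MonoidAlgebra ℤ G) (hh : h ∈ Subring.center (MonoidAlgebra ℤ G))
    (s : G) (hs : r ∣ orderOf s) : (r : ℤ) ^ (m + 1) ∣ (h ^ (r ^ n)).coeff s := by
  set z : G := s ^ (r ^ n) with hz
  set u : G := z⁻¹ * s with hu
  have hzreg : ¬ r ∣ orderOf z := by
    obtain ⟨t, rfl⟩ := Nat.exists_eq_add_of_le hn
    have : z = (s ^ (r ^ (m + t))) ^ (r ^ e) := by
      rw [hz, ← pow_mul, ← pow_add]; congr 2; ring
    rw [this]; exact hReg _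
  have hsz : Commute s z := (Commute.refl s).pow_right _
  have hu1 : u ≠ 1 := by
    intro h1
    have : s = z := by
      have := inv_mul_eq_one.1 h1
      exact this.symm
    rw [← this] at hzreg
    exact hzreg hs
  have huE : u ^ (r ^ e) = 1 := by
    have h1 := hR _ (hReg s)
    rw [hu, (hsz.symm.inv_left).mul_pow, inv_pow, hz, ← pow_mul, mul_comm (r ^ n), pow_mul, h1]
    simp
  have huz : Commute u z := (Commute.refl z).inv_left.mul_left hsz
  have key := coeff_conj (m := m) (n := n) hr hE hn (MonoidAlgebra.single z⁻¹ 1 * h) u hu1 huE ?_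
  · rw [pow_single_mul h hh, MonoidAlgebra.coeff_single_mul_apply, inv_pow, hR z hzreg] at key
    simpa [hu] using key
  · intro g
    simp only [MonoidAlgebra.coeff_single_mul_apply, inv_inv, one_mul]
    rw [← coeff_center h hh u (z * g)]
    congr 1
    have : z * u⁻¹ = u⁻¹ * z := (huz.inv_left.eq).symm
    simp only [← mul_assoc, this]

lemma coeff_reg_modr {r e n : ℕ} (hr : r.Prime)
    (hE : ∀ (g : G) (j : ℕ), g ^ (r ^ j) = 1 → g ^ (r ^ e) = 1)
    (hR : ∀ z : G, ¬ r ∣ orderOf z → z ^ (r ^ n) = z)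
    (hn : e ≤ n) (h : MonoidAlgebra ℤ G) (hh : h ∈ Subring.center (MonoidAlgebra ℤ G))
    (z : G) (hz : ¬ r ∣ orderOf z) :
    (r : ℤ) ∣ (h ^ (r ^ n)).coeff z - ∑ u : G, if u ^ (r ^ e) = 1 then h.coeff (z * u) else 0 := by
  have key := coeff_one_modr hr hE hn (MonoidAlgebra.single z⁻¹ 1 * h)
  rw [pow_single_mul h hh, MonoidAlgebra.coeff_single_mul_apply, inv_pow, hR z hz] at key
  simpa using key

lemma coeff_reg_E {r e n m : ℕ} (hr : r.Prime)
    (hE : ∀ (g : G) (j : ℕ), g ^ (r ^ j) = 1 → g ^ (r ^ e) = 1)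
    (hR : ∀ z : G, ¬ r ∣ orderOf z → z ^ (r ^ n) = z)
    (hn : m + e ≤ n) (h : MonoidAlgebra ℤ G) (hh : h ∈ Subring.center (MonoidAlgebra ℤ G))
    (z : G) (hz : ¬ r ∣ orderOf z) :
    (r : ℤ) ^ (m + 1) ∣ ∑ u : G, if u ^ (r ^ e) = 1 ∧ u ≠ 1 then (h ^ (r ^ n)).coeff (z * u) else 0 := by
  have key := coeff_sum_E (m := m) (n := n) hr hE hn (MonoidAlgebra.single z⁻¹ 1 * h)
  simp only [pow_single_mul h hh, MonoidAlgebra.coeff_single_mul_apply, inv_pow, hR z hz, inv_inv, one_mul] at key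
  exact key

lemma approx {r e n m : ℕ} (hr : r.Prime)
    (hE : ∀ (g : G) (j : ℕ), g ^ (r ^ j) = 1 → g ^ (r ^ e) = 1)
    (hReg : ∀ g : G, ¬ r ∣ orderOf (g ^ (r ^ e)))
    (hR : ∀ z : G, ¬ r ∣ orderOf z → z ^ (r ^ n) = z)
    (hn : m + e ≤ n) (i : ℕ) : i ≤ m → ∀ h : MonoidAlgebra ℤ G, h ∈ Subring.center (MonoidAlgebra ℤ G) →
    (∀ s, r ∣ orderOf s → (r : ℤ) ^ i ∣ h.coeff s) →
    (∀ z, ¬ r ∣ orderOf z → (r : ℤ) ^ i ∣ ∑ u : G, if u ^ (r ^ e) = 1 ∧ u ≠ 1 then h.coeff (z * u) else 0) →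
    ∃ a ∈ Subring.closure (Set.image (fun k : MonoidAlgebra ℤ G => k ^ (r ^ n)) (Subring.center (MonoidAlgebra ℤ G) : Set (MonoidAlgebra ℤ G))),
      ∃ v : MonoidAlgebra ℤ G, h = a + ((r : ℤ) ^ i) • v := by
  have hr0 : (r : ℤ) ≠ 0 := by exact_mod_cast hr.ne_zero
  induction i with
  | zero => exact fun _ h _ _ _ => ⟨0, zero_mem _, h, by simp⟩
  | succ i ih =>
    intro hi h hh h1 h2
    have hq : h ^ (r ^ n) ∈ Subring.center (MonoidAlgebra ℤ G) := pow_mem hh _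
    have hmod : ∀ s, (r : ℤ) ∣ (h - h ^ (r ^ n)).coeff s := by
      intro s
      rw [MonoidAlgebra.coeff_sub, Finsupp.sub_apply]
      by_cases hs : r ∣ orderOf s
      · refine dvd_sub ((dvd_pow_self _ (by omega)).trans (h1 s hs)) ?_
        have := coeff_nonreg (m := 0) hr hE hReg hR (by omega) h hh s hs
        simpa using this
      · have k1 := coeff_reg_modr hr hE hR (by omega) h hh s hs
        have k2 : (r : ℤ) ∣ _ := (dvd_pow_self (r : ℤ) (by omega : i + 1 ≠ 0)).trans (h2 s hs)
        have k3 : (∑ u : G, if u ^ (r ^ e) = 1 then h.coeff (s * u) else 0) =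
            h.coeff s + ∑ u : G, if u ^ (r ^ e) = 1 ∧ u ≠ 1 then h.coeff (s * u) else 0 := by
          have : h.coeff s = ∑ u : G, if u = 1 then h.coeff (s * u) else 0 := by simp
          rw [this, ← Finset.sum_add_distrib]
          refine Finset.sum_congr rfl fun u _ => ?_
          by_cases hu : u = 1
          · simp [hu]
          · simp [hu]
        rw [k3] at k1
        have := dvd_add k1 k2
        rw [← dvd_neg]
        convert this using 1
        ring
    choose f hf using hmod
    let w : MonoidAlgebra ℤ G := MonoidAlgebra.ofCoeff (Finsupp.equivFunOnFinite.symm f)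
    have hw : ∀ s, w.coeff s = f s := fun s => rfl
    have hwc : ∀ s, (r : ℤ) * w.coeff s = h.coeff s - (h ^ (r ^ n)).coeff s := by
      intro s
      rw [hw, ← hf, MonoidAlgebra.coeff_sub, Finsupp.sub_apply]
    have hwcent : w ∈ Subring.center (MonoidAlgebra ℤ G) := by
      apply mem_center_of_coeff
      intro k g
      apply mul_left_cancel₀ hr0
      rw [hwc, hwc, coeff_center' h hh, coeff_center' _ hq]
    have c1 : ∀ s, r ∣ orderOf s → (r : ℤ) ^ i ∣ w.coeff s := by
      intro s hs
      have := dvd_sub (h1 s hs) (coeff_nonreg (m := i) hr hE hReg hR (by omega) h hh s hs)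
      rw [← hwc, pow_succ'] at this
      exact Int.dvd_of_mul_dvd_mul_left hr0 this
    have c2 : ∀ z, ¬ r ∣ orderOf z → (r : ℤ) ^ i ∣ ∑ u : G, if u ^ (r ^ e) = 1 ∧ u ≠ 1 then w.coeff (z * u) else 0 := by
      intro z hz
      have := dvd_sub (h2 z hz) (coeff_reg_E (m := i) hr hE hR (by omega) h hh z hz)
      rw [← Finset.sum_sub_distrib] at this
      have e2 : (∑ u : G, ((if u ^ (r ^ e) = 1 ∧ u ≠ 1 then h.coeff (z * u) else 0) -
          if u ^ (r ^ e) = 1 ∧ u ≠ 1 then (h ^ (r ^ n)).coeff (z * u) else 0)) =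
          r * ∑ u : G, if u ^ (r ^ e) = 1 ∧ u ≠ 1 then w.coeff (z * u) else 0 := by
        rw [Finset.mul_sum]
        refine Finset.sum_congr rfl fun u _ => ?_
        split_ifs
        · rw [hwc]
        · simp
      rw [e2, pow_succ'] at this
      exact Int.dvd_of_mul_dvd_mul_left hr0 this
    obtain ⟨a, ha, v, hv⟩ := ih (by omega) w hwcent c1 c2
    refine ⟨h ^ (r ^ n) + (r : ℤ) • a, add_mem (Subring.subset_closure ⟨h, hh, rfl⟩) (zsmul_mem ha _), v, ?_⟩
    have : h = h ^ (r ^ n) + (r : ℤ) • w := by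
      ext s
      have := hwc s
      simp only [MonoidAlgebra.coeff_add, Finsupp.add_apply, MonoidAlgebra.coeff_smul, Finsupp.smul_apply, smul_eq_mul]
      rw [this]; ring
    conv_lhs => rw [this, hv]
    rw [smul_add, smul_smul, ← pow_succ', add_assoc]

lemma closure_nonreg {r e n m : ℕ} (hr : r.Prime)
    (hE : ∀ (g : G) (j : ℕ), g ^ (r ^ j) = 1 → g ^ (r ^ e) = 1)
    (hReg : ∀ g : G, ¬ r ∣ orderOf (g ^ (r ^ e)))
    (hR : ∀ z : G, ¬ r ∣ orderOf z → z ^ (r ^ n) = z)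
    (hn : m + e ≤ n) (a : MonoidAlgebra ℤ G)
    (ha : a ∈ Subring.closure (Set.image (fun k : MonoidAlgebra ℤ G => k ^ (r ^ n)) (Subring.center (MonoidAlgebra ℤ G) : Set (MonoidAlgebra ℤ G))))
    (s : G) (hs : r ∣ orderOf s) : (r : ℤ) ^ m ∣ a.coeff s := by
  rw [Subring.mem_closure_iff] at ha
  induction ha using AddSubgroup.closure_induction with
  | mem x hx =>
    have : ∃ k ∈ Subring.center (MonoidAlgebra ℤ G), k ^ (r ^ n) = x := by
      induction hx using Submonoid.closure_induction with
      | mem x hx => exact hx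
      | one => exact ⟨1, one_mem _, one_pow _⟩
      | mul x y _ _ hx hy =>
        obtain ⟨k, hk, rfl⟩ := hx
        obtain ⟨l, hl, rfl⟩ := hy
        refine ⟨k * l, mul_mem hk hl, ?_⟩
        have hc : Commute k l := (Subring.mem_center_iff.1 hl) _
        exact hc.mul_pow _
    obtain ⟨k, hk, rfl⟩ := this
    exact (pow_dvd_pow _ (Nat.le_succ m)).trans (coeff_nonreg hr hE hReg hR hn k hk s hs)
  | zero => simp
  | add x y _ _ hx hy =>
    rw [MonoidAlgebra.coeff_add, Finsupp.add_apply]; exact dvd_add hx hy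
  | neg x _ hx =>
    rw [MonoidAlgebra.coeff_neg, Finsupp.neg_apply]; exact (dvd_neg).2 hx

/-- powers of an isolated central element vanish off the `r`-regular elements -/
lemma pow_nonreg {r : ℕ} (hr : r.Prime) (h : MonoidAlgebra ℤ G)
    (hh : h ∈ Subring.center (MonoidAlgebra ℤ G))
    (h1 : ∀ s, r ∣ orderOf s → h.coeff s = 0)
    (h2 : ∀ z u : G, ¬ r ∣ orderOf z → u ≠ 1 → (∃ j, u ^ (r ^ j) = 1) → h.coeff (z * u) = 0)
    (N : ℕ) (s : G) (hs : r ∣ orderOf s) : (h ^ N).coeff s = 0 := by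
  obtain ⟨e, g', hg', hcard⟩ := Nat.exists_eq_pow_mul_and_not_dvd (n := Nat.card G) Nat.card_pos.ne' r hr.ne_one
  have hcop : Nat.Coprime r g' := (Nat.Prime.coprime_iff_not_dvd hr).2 hg'
  have hE : ∀ (g : G) (j : ℕ), g ^ (r ^ j) = 1 → g ^ (r ^ e) = 1 := by
    intro g j hg
    obtain ⟨i, -, hi⟩ := (Nat.dvd_prime_pow hr).1 (orderOf_dvd_of_pow_eq_one hg)
    have h3 : orderOf g ∣ r ^ e * g' := hcard ▸ orderOf_dvd_natCard g
    apply orderOf_dvd_iff_pow_eq_one.1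
    refine Nat.Coprime.dvd_of_dvd_mul_right ?_ h3
    rw [hi]; exact hcop.pow_left i
  have hReg : ∀ g : G, ¬ r ∣ orderOf (g ^ (r ^ e)) := by
    intro g hg
    apply hg'
    refine hg.trans (orderOf_dvd_of_pow_eq_one ?_)
    rw [← pow_mul, ← hcard, pow_card_eq_one']
  have main : ∀ m : ℕ, (r : ℤ) ^ m ∣ (h ^ N).coeff s := by
    intro m
    have hg0 : g' ≠ 0 := by rintro rfl; simp at hg'
    have hphi : 1 ≤ Nat.totient g' := Nat.totient_pos.2 (Nat.pos_of_ne_zero hg0)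
    let n := Nat.totient g' * (m + e)
    have hn : m + e ≤ n := Nat.le_mul_of_pos_left _ hphi
    have hR : ∀ z : G, ¬ r ∣ orderOf z → z ^ (r ^ n) = z := by
      intro z hz
      have h3 : orderOf z ∣ r ^ e * g' := hcard ▸ orderOf_dvd_natCard z
      have h4 : orderOf z ∣ g' :=
        Nat.Coprime.dvd_of_dvd_mul_left
          (((Nat.Prime.coprime_iff_not_dvd hr).2 hz).symm.pow_right e) h3
      have h5 : r ^ n ≡ 1 [MOD g'] := by
        have := (Nat.ModEq.pow_totient hcop).pow (m + e)
        rwa [← pow_mul, one_pow] at this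
      have h6 : r ^ n ≡ 1 [MOD orderOf z] := h5.of_dvd h4
      have := pow_eq_pow_iff_modEq.2 h6
      rwa [pow_one] at this
    obtain ⟨a, ha, v, hv⟩ := approx hr hE hReg hR hn m le_rfl h hh
      (fun s hs => by rw [h1 s hs]; exact dvd_zero _)
      (fun z hz => by
        rw [Finset.sum_eq_zero]
        · exact dvd_zero _
        · intro u _
          split_ifs with hu
          · exact h2 z u hz hu.2 ⟨e, hu.1⟩
          · rfl)
    have hpow : ∀ N : ℕ, ∃ v' : MonoidAlgebra ℤ G, h ^ N = a ^ N + ((r : ℤ) ^ m) • v' := by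
      intro N
      induction N with
      | zero => exact ⟨0, by simp⟩
      | succ N ihN =>
        obtain ⟨v', hv'⟩ := ihN
        refine ⟨a ^ N * v + v' * h, ?_⟩
        rw [pow_succ, hv', add_mul, smul_mul_assoc]
        conv_lhs => rw [show a ^ N * h = a ^ N * (a + ((r : ℤ) ^ m) • v) by rw [← hv]]
        rw [mul_add, ← pow_succ, mul_smul_comm, add_assoc, ← smul_add]
    obtain ⟨v', hv'⟩ := hpow N
    rw [hv', MonoidAlgebra.coeff_add, Finsupp.add_apply, MonoidAlgebra.coeff_smul, Finsupp.smul_apply, smul_eq_mul]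
    exact dvd_add (closure_nonreg hr hE hReg hR hn _ (pow_mem ha N) s hs) (dvd_mul_right _ _)
  by_contra hne
  have hfin := (Int.finiteMultiplicity_iff (a := (r : ℤ)) (b := (h ^ N).coeff s)).2
    ⟨by simpa using hr.ne_one, hne⟩
  obtain ⟨k, hk⟩ := hfin
  exact hk (main (k + 1))
end words

lemma normalClosure_regular {G : Type*} [Group G] [Finite G] {r : ℕ} (hr : r.Prime) (x : G)
    (hx : ¬ r ∣ orderOf x)
    (H : ∀ y : G, y ≠ 1 → (∃ n : ℕ, orderOf y = r ^ n) → r ∣ orderOf (x * y)) :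
    ∀ g ∈ Subgroup.normalClosure {x}, ¬ r ∣ orderOf g := by
  classical
  have := Fintype.ofFinite G
  let K : MonoidAlgebra ℤ G := MonoidAlgebra.ofCoeff
    (Finsupp.equivFunOnFinite.symm (fun g => if IsConj x g then (1 : ℤ) else 0))
  have hK : ∀ g, K.coeff g = if IsConj x g then (1 : ℤ) else 0 := fun g => rfl
  have hord : ∀ c g : G, orderOf (c * g * c⁻¹) = orderOf g := fun c g => by
    rw [← MulAut.conj_apply]; exact orderOf_injective (MulAut.conj c).toMonoidHom (MulAut.conj c).injective g
  have hcent : K ∈ Subring.center (MonoidAlgebra ℤ G) := by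
    apply mem_center_of_coeff
    intro k g
    rw [hK, hK]
    have : IsConj (g * k) (k * g) := isConj_iff.2 ⟨k, by group⟩
    congr 1
    rw [eq_iff_iff]
    exact ⟨fun h => h.trans this, fun h => h.trans this.symm⟩
  have key : ∀ N s, r ∣ orderOf s → (K ^ N).coeff s = 0 := by
    intro N s hs
    refine pow_nonreg hr K hcent ?_ ?_ N s hs
    · intro s hs
      rw [hK, if_neg]
      intro h
      obtain ⟨c, rfl⟩ := isConj_iff.1 h
      rw [hord] at hs
      exact hx hs
    · rintro z u hz hu ⟨j, hj⟩
      rw [hK, if_neg]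
      intro h
      obtain ⟨c, hc⟩ := isConj_iff.1 h
      apply hz
      have hz' : z = c * (x * (c⁻¹ * u⁻¹ * c⁻¹⁻¹)) * c⁻¹ := by
        have : z = c * x * c⁻¹ * u⁻¹ := by rw [hc]; group
        rw [this]; group
      rw [hz', hord]
      apply H
      · rw [Ne, conj_eq_one_iff, inv_eq_one]; exact hu
      · rw [hord, orderOf_inv]
        obtain ⟨i, -, hi⟩ := (Nat.dvd_prime_pow hr).1 (orderOf_dvd_of_pow_eq_one hj)
        exact ⟨i, hi⟩
  have hnn : ∀ N g, 0 ≤ (K ^ N).coeff g := by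
    intro N g
    rw [coeff_pow_words]
    refine Finset.sum_nonneg fun v _ => ?_
    split_ifs
    · apply List.prod_nonneg
      intro a ha
      obtain ⟨g, -, rfl⟩ := List.mem_map.1 ha
      rw [hK]; split_ifs <;> norm_num
    · rfl
  have hpos : ∀ l : List G, (∀ g ∈ l, IsConj x g) → 0 < (K ^ l.length).coeff l.prod := by
    intro l hl
    rw [coeff_pow_words]
    refine Finset.sum_pos' (fun v _ => ?_) ⟨⟨l, rfl⟩, Finset.mem_univ _, ?_⟩
    · split_ifs
      · apply List.prod_nonneg
        intro a ha
        obtain ⟨g, -, rfl⟩ := List.mem_map.1 ha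
        rw [hK]; split_ifs <;> norm_num
      · rfl
    · rw [if_pos rfl]
      apply List.prod_pos
      intro a ha
      obtain ⟨g, hg, rfl⟩ := List.mem_map.1 ha
      rw [hK, if_pos (hl g hg)]; norm_num
  intro g hg hdvd
  have hmem : g ∈ Submonoid.closure (Group.conjugatesOfSet {x}) := by
    have : g ∈ (Subgroup.closure (Group.conjugatesOfSet {x})).toSubmonoid := hg
    rwa [Subgroup.closure_toSubmonoid_of_finite] at this
  obtain ⟨l, hl, rfl⟩ := Submonoid.exists_list_of_mem_closure hmem
  have := hpos l (fun g hg => by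
    have := hl g hg
    rw [Group.mem_conjugatesOfSet_iff] at this
    obtain ⟨a, ha, h⟩ := this
    rw [Set.mem_singleton_iff] at ha
    rwa [ha] at h)
  rw [key _ _ hdvd] at this
  exact lt_irrefl _ this

end Aux

lemma normal_le_sylow_aux {G : Type*} [Group G] [Finite G] {p : ℕ} [Fact p.Prime] (H : Subgroup G)
    (hn : H.Normal) (hH : IsPGroup p H) (P : Sylow p G) : H ≤ P := by
  obtain ⟨Q, hQ⟩ := hH.exists_le_sylow
  obtain ⟨g, hg⟩ := MulAction.exists_smul_eq G Q P
  intro h hh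
  rw [← hg]
  have h1 : g⁻¹ * h * g⁻¹⁻¹ ∈ H := hn.conj_mem h hh g⁻¹
  have h2 := hQ h1
  change h ∈ (g • Q : Sylow p G)
  rw [Sylow.smul_def]
  refine ⟨_, h2, ?_⟩
  simp [MulAut.smul_def, mul_assoc]

lemma pCore_isPGroup {G : Type*} [Group G] [Finite G] {p : ℕ} (hp : p.Prime) :
    IsPGroup p (pCore p G) := by
  have := Fact.mk hp
  let P : Sylow p G := default
  exact P.2.to_le (sSup_le fun H hH => normal_le_sylow_aux H hH.1 hH.2 P)

/-- **Theorem E.** A `p`-element `x` of a finite group `G` lies in `O_p(G)` if and only if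
`r` divides `o(xy)` for every prime `r ≠ p` and every nontrivial `r`-element `y ∈ G`. -/
theorem statement4 {G : Type*} [Group G] [Finite G] {p : ℕ} (hp : p.Prime)
    (x : G) (hx : IsPElement p x) :
    x ∈ pCore p G ↔ ∀ r : ℕ, r.Prime → r ≠ p → ∀ y : G, y ≠ 1 →
      (∃ n : ℕ, orderOf y = r ^ n) → r ∣ orderOf (x * y) := by
  constructor
  · rintro hxc r hr hrp y hy ⟨n, hn⟩
    by_contra hnd
    set k := orderOf (x * y) with hk
    have h1 : ((x * y : G) : G ⧸ pCore p G) = (y : G ⧸ pCore p G) := by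
      rw [QuotientGroup.mk_mul, (QuotientGroup.eq_one_iff x).2 hxc, one_mul]
    have h2 : y ^ k ∈ pCore p G := by
      rw [← QuotientGroup.eq_one_iff, QuotientGroup.mk_pow, ← h1, ← QuotientGroup.mk_pow,
        hk, pow_orderOf_eq_one, QuotientGroup.mk_one]
    obtain ⟨j, hj⟩ := pCore_isPGroup hp ⟨_, h2⟩
    have hj' : (y ^ k) ^ p ^ j = 1 := congrArg Subtype.val hj
    rw [← pow_mul] at hj'
    have h3 := orderOf_dvd_of_pow_eq_one hj'
    have hn0 : n ≠ 0 := by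
      rintro rfl
      rw [pow_zero, orderOf_eq_one_iff] at hn
      exact hy hn
    have h4 : r ∣ k * p ^ j := (hn ▸ dvd_pow_self r hn0 : r ∣ orderOf y).trans h3
    rcases (Nat.Prime.dvd_mul hr).1 h4 with h | h
    · exact hnd h
    · exact hrp ((Nat.prime_dvd_prime_iff_eq hr hp).1 (hr.dvd_of_dvd_pow h))
  · intro H
    have hreg : ∀ r : ℕ, r.Prime → r ≠ p → ∀ g ∈ Subgroup.normalClosure {x}, ¬ r ∣ orderOf g := by
      intro r hr hrp
      refine normalClosure_regular hr x ?_ (H r hr hrp)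
      obtain ⟨n, hn⟩ := hx
      rw [hn]
      intro h
      exact hrp ((Nat.prime_dvd_prime_iff_eq hr hp).1 (hr.dvd_of_dvd_pow h))
    have hP : IsPGroup p (Subgroup.normalClosure {x}) := by
      have := Fact.mk hp
      rw [IsPGroup.iff_orderOf]
      rintro ⟨g, hg⟩
      rw [Subgroup.orderOf_mk]
      refine ⟨_, Nat.eq_prime_pow_of_unique_prime_dvd (orderOf_pos g).ne' ?_⟩
      intro d hd hdvd
      by_contra hne
      exact hreg d hd hne g hg hdvd
    exact le_sSup (a := Subgroup.normalClosure {x})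
      (s := {H : Subgroup G | H.Normal ∧ IsPGroup p H}) ⟨Subgroup.normalClosure_normal, hP⟩
      (Subgroup.subset_normalClosure rfl)
end

section
/- Let G be a finite group, p a prime dividing |G|, and R a weakly subnormal p-subgroup of G. Then: (i) G is the normal closure of R; (ii) R is contained in a unique maximal subgroup M of G, and R ≤ O_p(M); (iii) R is subnormal in RΦ(G), and O_{p'}(G) ∩ Φ(G) ≤ Z(G); (iv) either O_{p'}(G) ≤ Z(G) ∩ Φ(G), or G = QR where Q is a normal q-subgroup of G for some prime q and R acts irreducibly on Q/Φ(Q) and centralizes Φ(Q); (v) in the first case of (iv), the Fitting subgroup F(G) is contained in M. -/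
open Subgroup in
theorem normalIn_iff {G : Type*} [Group G] {H K : Subgroup G} :
    NormalIn H K ↔ H ≤ K ∧ K ≤ normalizer (H : Set G) := by
  rw [NormalIn, le_normalizer_iff]

theorem subnormal_iff_rtg {G : Type*} [Group G] {H K : Subgroup G} :
    Subnormal H K ↔ Relation.ReflTransGen NormalIn H K := by
  constructor
  · rintro ⟨n, c, h0, hn, hc⟩
    have : ∀ i : Fin (n + 1), Relation.ReflTransGen NormalIn H (c i) := by
      intro i
      induction i using Fin.induction with
      | zero => rw [h0]
      | succ i ih => exact ih.tail (hc i)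
    rw [← hn]
    exact this _
  · intro h
    induction h with
    | refl => exact ⟨0, fun _ => H, rfl, rfl, fun i => i.elim0⟩
    | @tail K L _ hKL ih =>
      obtain ⟨n, c, h0, hn, hc⟩ := ih
      refine ⟨n + 1, Fin.snoc c L, ?_, ?_, ?_⟩
      · rw [show (0 : Fin (n + 2)) = Fin.castSucc 0 from rfl]
        rw [Fin.snoc_castSucc (α := fun _ => Subgroup G)]
        exact h0
      · rw [Fin.snoc_last (α := fun _ => Subgroup G)]
      · intro i
        induction i using Fin.lastCases with
        | last =>
          rw [Fin.snoc_castSucc (α := fun _ => Subgroup G), hn, Fin.succ_last,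
            Fin.snoc_last (α := fun _ => Subgroup G)]
          exact hKL
        | cast i =>
          rw [Fin.snoc_castSucc (α := fun _ => Subgroup G), ← Fin.castSucc_succ,
            Fin.snoc_castSucc (α := fun _ => Subgroup G)]
          exact hc i

theorem NormalIn.subnormal {G : Type*} [Group G] {H K : Subgroup G} (h : NormalIn H K) :
    Subnormal H K := subnormal_iff_rtg.2 (.single h)

theorem Subnormal.trans {G : Type*} [Group G] {H K L : Subgroup G} (h : Subnormal H K)
    (h' : Subnormal K L) : Subnormal H L :=
  subnormal_iff_rtg.2 ((subnormal_iff_rtg.1 h).trans (subnormal_iff_rtg.1 h'))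

theorem Subnormal.le {G : Type*} [Group G] {H K : Subgroup G} (h : Subnormal H K) : H ≤ K := by
  rw [subnormal_iff_rtg] at h
  induction h with
  | refl => exact le_rfl
  | tail _ h ih => exact ih.trans h.1

/-- push a normal p-subgroup one level up -/
theorem pcore_up {G : Type*} [Group G] [Finite G] {p : ℕ} {P K L : Subgroup G}
    (hPK : NormalIn P K) (hP : IsPGroup p P) (hKL : NormalIn K L) :
    ∃ P', P ≤ P' ∧ NormalIn P' L ∧ IsPGroup p P' := by
  rw [normalIn_iff] at hPK hKL
  set S : Set (Subgroup G) :=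
    {X | X ≤ K ∧ K ≤ Subgroup.normalizer (X : Set G) ∧ IsPGroup p X} with hS
  obtain ⟨Z, hPZ, hZ⟩ := (Set.toFinite {X : Subgroup G | X ≤ K ∧ IsPGroup p X}).exists_le_maximal
    (show P ∈ {X : Subgroup G | X ≤ K ∧ IsPGroup p X} from ⟨hPK.1, hP⟩)
  have hSZ : sSup S ≤ Z := by
    refine sSup_le fun X hX => ?_
    have := hZ.2 (y := X ⊔ Z) ⟨sup_le hX.1 hZ.1.1,
      hX.2.2.to_sup_of_normal_left' hZ.1.2 (hZ.1.1.trans hX.2.1)⟩ le_sup_right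
    exact le_sup_left.trans this
  refine ⟨sSup S, le_sSup ⟨hPK.1, hPK.2, hP⟩, normalIn_iff.2 ⟨?_, ?_⟩, hZ.1.2.to_le hSZ⟩
  · exact (hSZ.trans hZ.1.1).trans hKL.1
  · rw [Subgroup.le_normalizer_iff]
    intro l hl x hx
    have hKconj := Subgroup.le_normalizer_iff.1 hKL.2
    have : sSup S ≤ (sSup S).comap (MulAut.conj l).toMonoidHom := by
      refine sSup_le fun X hX => ?_
      rw [← Subgroup.map_le_iff_le_comap]
      refine le_sSup ⟨?_, ?_, hX.2.2.map _⟩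
      · rintro _ ⟨y, hy, rfl⟩
        exact hKconj l hl y (hX.1 hy)
      · rw [Subgroup.le_normalizer_iff]
        rintro k hk _ ⟨y, hy, rfl⟩
        have h1 : l⁻¹ * k * l ∈ K := by simpa using hKconj l⁻¹ (L.inv_mem hl) k hk
        refine ⟨_, Subgroup.le_normalizer_iff.1 hX.2.1 _ h1 y hy, ?_⟩
        simp only [MulEquiv.coe_toMonoidHom, MulAut.conj_apply]
        group
    simpa using this hx

theorem psub_of_subnormal {G : Type*} [Group G] [Finite G] {p : ℕ} {R H : Subgroup G}
    (hR : IsPGroup p R) (h : Subnormal R H) :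
    ∃ P, R ≤ P ∧ NormalIn P H ∧ IsPGroup p P := by
  rw [subnormal_iff_rtg] at h
  induction h with
  | refl => exact ⟨R, le_rfl, normalIn_iff.2 ⟨le_rfl, Subgroup.le_normalizer⟩, hR⟩
  | tail _ h ih =>
    obtain ⟨P, h1, h2, h3⟩ := ih
    obtain ⟨P', h4, h5, h6⟩ := pcore_up h2 h3 h
    exact ⟨P', h1.trans h4, h5, h6⟩

theorem subnormal_of_pgroup {G : Type*} [Group G] [Finite G] {p : ℕ} (hp : p.Prime)
    {P : Subgroup G} (hP : IsPGroup p P) {R : Subgroup G} (hRP : R ≤ P) : Subnormal R P := by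
  have : Fact p.Prime := ⟨hp⟩
  have hnc : NormalizerCondition P :=
    have := hP.isNilpotent
    Group.normalizerCondition_of_isNilpotent
  induction hn : Nat.card G - Nat.card R using Nat.strong_induction_on generalizing R with
  | _ n ih =>
    rcases eq_or_lt_of_le hRP with rfl | hlt
    · exact subnormal_iff_rtg.2 .refl
    have h1 := hnc (R.subgroupOf P) (by
      rw [lt_top_iff_ne_top, Ne, Subgroup.subgroupOf_eq_top]
      exact fun h => hlt.not_ge h)
    rw [← Subgroup.subgroupOf_normalizer_eq hRP] at h1
    set N := P ⊓ Subgroup.normalizer (R : Set G)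
    have hRN : R ≤ N := le_inf hRP Subgroup.le_normalizer
    have hne : R ≠ N := by
      intro h
      obtain ⟨x, hx, hx'⟩ := SetLike.exists_of_lt h1
      refine hx' ?_
      rw [Subgroup.mem_subgroupOf] at hx ⊢
      rw [h]
      exact ⟨x.2, hx⟩
    have hcard : Nat.card R < Nat.card N := by
      refine lt_of_le_of_ne (Subgroup.card_le_of_le hRN) fun h => hne ?_
      exact Subgroup.eq_of_le_of_card_ge hRN h.ge
    have hN := ih (Nat.card G - Nat.card N) (by
      have := Subgroup.card_le_card_group N; omega) (R := N) inf_le_left rfl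
    exact Subnormal.trans (NormalIn.subnormal (normalIn_iff.2 ⟨hRN, inf_le_right⟩)) hN

theorem subnormal_iff {G : Type*} [Group G] [Finite G] {p : ℕ} (hp : p.Prime)
    {R : Subgroup G} (hR : IsPGroup p R) {H : Subgroup G} :
    Subnormal R H ↔ ∃ P, R ≤ P ∧ NormalIn P H ∧ IsPGroup p P :=
  ⟨psub_of_subnormal hR, fun ⟨_, h1, h2, h3⟩ => (subnormal_of_pgroup hp h3 h1).trans h2.subnormal⟩

theorem subnormal_sup {G : Type*} [Group G] [Finite G] {p : ℕ} (hp : p.Prime)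
    {R T H : Subgroup G} (hR : IsPGroup p R) (hT : IsPGroup p T) (hRH : Subnormal R H)
    (hTH : Subnormal T H) : Subnormal (R ⊔ T) H := by
  obtain ⟨P, h1, h2, h3⟩ := psub_of_subnormal hR hRH
  obtain ⟨Q, k1, k2, k3⟩ := psub_of_subnormal hT hTH
  rw [normalIn_iff] at h2 k2
  have hp' : IsPGroup p (P ⊔ Q : Subgroup G) := h3.to_sup_of_normal_left' k3 (k2.1.trans h2.2)
  have hle : R ⊔ T ≤ P ⊔ Q := sup_le_sup h1 k1
  refine (subnormal_iff hp (hp'.to_le hle)).2 ⟨_, hle, normalIn_iff.2 ⟨sup_le h2.1 k2.1, ?_⟩, hp'⟩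
  rw [Subgroup.le_normalizer_iff]
  intro h hh x hx
  have h2' := Subgroup.le_normalizer_iff.1 h2.2
  have k2' := Subgroup.le_normalizer_iff.1 k2.2
  have : P ⊔ Q ≤ (P ⊔ Q).comap (MulAut.conj h).toMonoidHom := by
    refine sup_le (fun y hy => ?_) fun y hy => ?_
    · exact Subgroup.mem_comap.2 ((le_sup_left : P ≤ P ⊔ Q) (h2' h hh y hy))
    · exact Subgroup.mem_comap.2 ((le_sup_right : Q ≤ P ⊔ Q) (k2' h hh y hy))
  exact this hx

theorem normalIn_conj {G : Type*} [Group G] {H K : Subgroup G} (h : NormalIn H K) (f : G →* G) :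
    NormalIn (H.map f) (K.map f) := by
  refine ⟨Subgroup.map_mono h.1, ?_⟩
  rintro _ ⟨k, hk, rfl⟩ _ ⟨x, hx, rfl⟩
  exact ⟨_, h.2 k hk x hx, by simp⟩

theorem subnormal_conj {G : Type*} [Group G] {H K : Subgroup G} (h : Subnormal H K) (f : G →* G) :
    Subnormal (H.map f) (K.map f) := by
  obtain ⟨n, c, h0, h1, h2⟩ := h
  exact ⟨n, fun i => (c i).map f, by simp [h0], by simp [h1], fun i => normalIn_conj (h2 i) f⟩

theorem exists_conj_of_subnormal {G : Type*} [Group G] {T K : Subgroup G} (h : Subnormal T K)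
    (hK : ∀ x ∈ K, T.map (MulAut.conj x).toMonoidHom ≤ Subgroup.normalizer (T : Set G) →
      T.map (MulAut.conj x).toMonoidHom ≤ T) :
    K ≤ Subgroup.normalizer (T : Set G) := by
  have h := subnormal_iff_rtg.1 h
  induction h with
  | refl => exact Subgroup.le_normalizer
  | @tail A B hA hAB ih =>
    have hTA : Subnormal T A := subnormal_iff_rtg.2 hA
    have ih := ih hTA fun x hx => hK x (hAB.1 hx)
    rw [Subgroup.le_normalizer_iff]
    intro x hx t ht
    refine hK x hx ?_ ⟨t, ht, rfl⟩
    rintro _ ⟨s, hs, rfl⟩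
    exact ih (hAB.2 x hx s (hTA.le hs))

theorem unique_max {G : Type*} [Group G] [Finite G] {p : ℕ} (hp : p.Prime) {R : Subgroup G}
    (hRp : IsPGroup p R) (hw : WeaklySubnormal R) {M K : Subgroup G} (hM : IsCoatom M)
    (hK : IsCoatom K) (hRM : R ≤ M) (hRK : R ≤ K) : M = K := by
  induction hn : Nat.card G - Nat.card R using Nat.strong_induction_on generalizing R M K with
  | _ n ih =>
    have hRn : Subgroup.normalizer (R : Set G) ≠ ⊤ := by
      intro h
      exact hw.1 (normalIn_iff.2 ⟨le_top, h.ge⟩).subnormal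
    obtain ⟨L, hL, hNL⟩ := (eq_top_or_exists_le_coatom (Subgroup.normalizer (R : Set G))).resolve_left
      hRn
    -- every coatom containing R equals L
    have key : ∀ K : Subgroup G, IsCoatom K → R ≤ K → K = L := by
      intro K hK hRK
      by_contra hne
      have hnot : ¬ K ≤ Subgroup.normalizer (R : Set G) := fun h =>
        hne ((hK.le_iff_eq hL.1).1 (h.trans hNL)).symm
      have := mt (exists_conj_of_subnormal (hw.2 K hRK hK.1)) hnot
      push Not at this
      obtain ⟨x, hxK, hx1, hx2⟩ := this
      set R' := R.map (MulAut.conj x).toMonoidHom with hR'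
      have hR'p : IsPGroup p R' := hRp.map _
      have hTp : IsPGroup p (R ⊔ R' : Subgroup G) := hRp.to_sup_of_normal_left' hR'p hx1
      have hTN : R ⊔ R' ≤ Subgroup.normalizer (R : Set G) := sup_le Subgroup.le_normalizer hx1
      have hTK : R ⊔ R' ≤ K := by
        refine sup_le hRK ?_
        rintro _ ⟨s, hs, rfl⟩
        exact K.mul_mem (K.mul_mem hxK (hRK hs)) (K.inv_mem hxK)
      have hcard : Nat.card R < Nat.card (R ⊔ R' : Subgroup G) := by
        refine lt_of_le_of_ne (Subgroup.card_le_of_le le_sup_left) fun h => hx2 ?_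
        have := Subgroup.eq_of_le_of_card_ge (le_sup_left : R ≤ R ⊔ R') h.ge
        rw [this]; exact le_sup_right.trans_eq (by rw [← this])
      have hTw : WeaklySubnormal (R ⊔ R') := by
        constructor
        · intro h
          exact hw.1 (Subnormal.trans (NormalIn.subnormal
            (normalIn_iff.2 ⟨le_sup_left, hTN⟩)) h)
        · intro H hH hHt
          refine subnormal_sup hp hRp hR'p (hw.2 H (le_sup_left.trans hH) hHt) ?_
          set f := (MulAut.conj x).toMonoidHom
          set g := (MulAut.conj x⁻¹).toMonoidHom
          have hfg : f.comp g = MonoidHom.id G := by ext y; simp [f, g, mul_assoc]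
          have hgf : g.comp f = MonoidHom.id G := by ext y; simp [f, g, mul_assoc]
          have h1 : R ≤ H.map g := by
            have := Subgroup.map_mono (f := g) (le_sup_right.trans hH : R' ≤ H)
            rwa [hR', Subgroup.map_map, hgf, Subgroup.map_id] at this
          have hfH : (H.map g).map f = H := by rw [Subgroup.map_map, hfg, Subgroup.map_id]
          have h2 : H.map g ≠ ⊤ := by
            intro h
            rw [h] at hfH
            apply hHt
            rw [← hfH]
            exact Subgroup.map_top_of_surjective f (MulAut.conj x).surjective
          have := subnormal_conj (hw.2 _ h1 h2) f
          rwa [hfH] at this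
      exact hne (ih _ (by have := Subgroup.card_le_card_group (R ⊔ R'); omega) hTp hTw hK hL hTK (hTN.trans hNL) rfl)
    rw [key M hM hRM, key K hK hRK]


theorem mem_of_pow_mem_coprime {G : Type*} [Group G] {H : Subgroup G} {z : G} {a b : ℕ}
    (hab : Nat.Coprime a b) (ha : z ^ a ∈ H) (hb : z ^ b ∈ H) : z ∈ H := by
  have h := Nat.gcd_eq_gcd_ab a b
  rw [hab] at h
  have h1 : z = (z ^ a) ^ (Nat.gcdA a b) * (z ^ b) ^ (Nat.gcdB a b) := by
    rw [← zpow_natCast, ← zpow_natCast, ← zpow_mul, ← zpow_mul, ← zpow_add, ← h]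
    simp
  rw [h1]
  exact H.mul_mem (H.zpow_mem ha _) (H.zpow_mem hb _)

theorem eq_top_of_sylow_le {H : Type*} [Group H] [Finite H] (K : Subgroup H)
    (h : ∀ q : ℕ, q.Prime → ∃ S : Sylow q H, (S : Subgroup H) ≤ K) : K = ⊤ := by
  by_contra hne
  have h1 : K.index ≠ 1 := fun h => hne (Subgroup.index_eq_one.1 h)
  obtain ⟨q, hq, hqd⟩ := Nat.exists_prime_and_dvd h1
  have : Fact q.Prime := ⟨hq⟩
  obtain ⟨S, hS⟩ := h q hq
  exact S.not_dvd_index (hqd.trans (Subgroup.index_dvd_of_le hS))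

theorem commutator_le_frattini_pgroup {Q : Type*} [Group Q] [Finite Q] {q : ℕ} (hq : q.Prime)
    (hQ : IsPGroup q Q) : commutator Q ≤ frattini Q := by
  have : Fact q.Prime := ⟨hq⟩
  have hnc : NormalizerCondition Q :=
    have := hQ.isNilpotent
    Group.normalizerCondition_of_isNilpotent
  refine le_iInf₂ fun M hM => ?_
  have hM' : IsCoatom M := hM
  have hMn : M.Normal := Subgroup.NormalizerCondition.normal_of_coatom _ hnc hM'
  have hq' : IsPGroup q (Q ⧸ M) := hQ.to_quotient M
  have : Nontrivial (Q ⧸ M) := QuotientGroup.nontrivial_iff.2 hM'.1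
  have hb := hq'.bot_lt_center
  set C := (Subgroup.center (Q ⧸ M)).comap (QuotientGroup.mk' M) with hC
  have hMC : M < C := by
    have h1 := (Subgroup.comap_lt_comap_of_surjective (QuotientGroup.mk'_surjective M)).2 hb
    rwa [MonoidHom.comap_bot, QuotientGroup.ker_mk'] at h1
  have hCt : C = ⊤ := hM'.2 _ hMC
  rw [commutator_def, Subgroup.commutator_le]
  intro a _ b _
  have ha : a ∈ C := hCt ▸ Subgroup.mem_top a
  rw [hC, Subgroup.mem_comap, Subgroup.mem_center_iff] at ha
  rw [← QuotientGroup.eq_one_iff, commutatorElement_def]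
  have := ha (QuotientGroup.mk' M b)
  simp only [QuotientGroup.mk'_apply] at this
  simp only [QuotientGroup.mk_mul, QuotientGroup.mk_inv]
  rw [← this]; group

theorem pPrimeCore_isPGroup {G : Type*} [Group G] [Finite G] {p : ℕ} (hp : p.Prime) :
    ∃ m : ℕ, m.Coprime p ∧ IsPGroup m (pPrimeCore p G) := by
  refine ⟨ordCompl[p] (Nat.card G), (Nat.coprime_ordCompl hp Nat.card_pos.ne').symm, ?_⟩
  refine Sylow.sSup_of_normal _ (fun H hH => ?_) fun H hH => hH.1
  refine IsPGroup.mono ?_ IsPGroup.card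
  have h1 := Subgroup.card_subgroup_dvd_card H
  rw [← Nat.ordProj_mul_ordCompl_eq_self (Nat.card G) p] at h1
  exact Nat.Coprime.dvd_of_dvd_mul_left (hH.2.pow_right _) h1

section WeaklySubnormalFacts
set_option linter.unusedSectionVars false
variable {G : Type*} [Group G] [Finite G] {p : ℕ} {R : Subgroup G}

theorem ws_top_of_normal (hw : WeaklySubnormal R) {X : Subgroup G} (hX : X.Normal) (hRX : R ≤ X) :
    X = ⊤ := by
  by_contra hne
  refine hw.1 ((hw.2 X hRX hne).trans (NormalIn.subnormal ⟨le_top, fun k _ h hh => ?_⟩))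
  exact hX.conj_mem h hh k

theorem ws_not_pgroup (hp : p.Prime) (hw : WeaklySubnormal R) {X : Subgroup G} (hX : IsPGroup p X)
    (hRX : R ≤ X) : X ≠ ⊤ := by
  rintro rfl
  exact hw.1 (subnormal_of_pgroup hp hX hRX)

theorem ws_central (hw : WeaklySubnormal R) {N : Subgroup G} (hN : N.Normal)
    (h : ∀ n ∈ N, ∀ r ∈ R, n * r = r * n) : N ≤ Subgroup.center G := by
  have hC : R ≤ Subgroup.centralizer (N : Set G) := fun r hr =>
    Subgroup.mem_centralizer_iff.2 fun n hn => h n hn r hr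
  have := ws_top_of_normal hw inferInstance hC
  intro n hn
  rw [Subgroup.mem_center_iff]
  intro g
  have hg : g ∈ Subgroup.centralizer (N : Set G) := this ▸ Subgroup.mem_top g
  exact (Subgroup.mem_centralizer_iff.1 hg n hn).symm

theorem ws_commute (hRp : IsPGroup p R) (hw : WeaklySubnormal R) {N : Subgroup G} {m : ℕ}
    (hN : IsPGroup m N) (hm : m.Coprime p) (hRN : R ≤ Subgroup.normalizer (N : Set G))
    (hne : N ⊔ R ≠ ⊤) : ∀ n ∈ N, ∀ r ∈ R, n * r = r * n := by
  obtain ⟨P, h1, h2, h3⟩ := psub_of_subnormal hRp (hw.2 _ le_sup_right hne)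
  intro n hn r hr
  have hd := IsPGroup.disjoint_of_coprime hN h3 hm
  have hnH : n ∈ N ⊔ R := (le_sup_left : N ≤ N ⊔ R) hn
  have e1 : n * r * n⁻¹ * r⁻¹ ∈ P := P.mul_mem (h2.2 n hnH r (h1 hr)) (P.inv_mem (h1 hr))
  have e2 : n * r * n⁻¹ * r⁻¹ ∈ N := by
    rw [mul_assoc, mul_assoc]
    refine N.mul_mem hn ?_
    rw [← mul_assoc]
    exact Subgroup.le_normalizer_iff.1 hRN r hr _ (N.inv_mem hn)
  have := Subgroup.disjoint_def.1 hd e2 e1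
  rwa [mul_inv_eq_one, mul_inv_eq_iff_eq_mul] at this

theorem eq_one_of_coprime {A : Type*} [Group A] {a b : ℕ} (hab : a.Coprime b) {x : A}
    (ha : x ^ a = 1) (hb : x ^ b = 1) : x = 1 := by
  have := mem_of_pow_mem_coprime (H := (⊥ : Subgroup A)) hab
    (Subgroup.mem_bot.2 ha) (Subgroup.mem_bot.2 hb)
  exact Subgroup.mem_bot.1 this

/-- a homomorphism to an `m`-group kills everything -/
theorem ws_hom_trivial (hRp : IsPGroup p R) (hw : WeaklySubnormal R) {A : Type*} [Group A] {m : ℕ}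
    (hA : IsPGroup m A) (hm : m.Coprime p) (f : G →* A) (g : G) : f g = 1 := by
  have h : f.ker = ⊤ := by
    refine ws_top_of_normal hw inferInstance fun r hr => ?_
    obtain ⟨k, hk⟩ := hRp ⟨r, hr⟩
    obtain ⟨j, hj⟩ := hA (f r)
    rw [MonoidHom.mem_ker]
    refine eq_one_of_coprime (hm.pow j k) hj ?_
    rw [← map_pow]
    have := congrArg Subtype.val hk
    simp only [Subgroup.coe_pow, Subgroup.coe_one] at this
    rw [this, map_one]
  exact MonoidHom.mem_ker.1 (h ▸ Subgroup.mem_top g)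

theorem ws_central_le_frattini (hRp : IsPGroup p R) (hw : WeaklySubnormal R) {N : Subgroup G}
    {m : ℕ} (hN : IsPGroup m N) (hm : m.Coprime p) (hc : N ≤ Subgroup.center G) :
    N ≤ frattini G := by
  refine le_iInf₂ fun M hM => ?_
  have hM : IsCoatom M := hM
  by_contra hle
  have hsup : N ⊔ M = ⊤ := hM.2 _ (right_lt_sup.2 hle)
  have hMn : M.Normal := by
    rw [← Subgroup.normalizer_eq_top_iff, eq_top_iff, ← hsup]
    refine sup_le ?_ Subgroup.le_normalizer
    rw [Subgroup.le_normalizer_iff]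
    intro n hn x hx
    rw [← Subgroup.mem_center_iff.1 (hc hn) x]
    simpa using hx
  have hA : IsPGroup m (G ⧸ M) := by
    refine hN.of_surjective ((QuotientGroup.mk' M).comp N.subtype) fun y => ?_
    obtain ⟨g, rfl⟩ := QuotientGroup.mk'_surjective M y
    have hg : g ∈ N ⊔ M := hsup ▸ Subgroup.mem_top g
    obtain ⟨n, hn, x, hx, rfl⟩ := Subgroup.mem_sup_of_normal_right.1 hg
    refine ⟨⟨n, hn⟩, ?_⟩
    simp [hx]
  apply hM.1
  rw [eq_top_iff]
  intro g _
  have := ws_hom_trivial hRp hw hA hm (QuotientGroup.mk' M) g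
  exact (QuotientGroup.eq_one_iff g).1 this

open scoped Pointwise in
/-- existence of an `R`-invariant Sylow `q`-subgroup of a normal `p'`-subgroup -/
theorem exists_invariant_sylow (hp : p.Prime) (hRp : IsPGroup p R) {N : Subgroup G} [N.Normal]
    {m : ℕ} (hN : IsPGroup m N) (hm : m.Coprime p) (q : ℕ) (hq : q.Prime) :
    ∃ S : Sylow q N, R ≤ Subgroup.normalizer
      (((S : Subgroup N).map N.subtype : Subgroup G) : Set G) := by
  have : Fact p.Prime := ⟨hp⟩
  have : Fact q.Prime := ⟨hq⟩
  let φ : R →* MulAut N := (MulAut.conjNormal : G →* MulAut N).comp R.subtype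
  let _ : MulAction R (Sylow q N) := MulAction.compHom _ φ
  have hcard : ¬ p ∣ Nat.card (Sylow q N) := by
    intro h
    have h1 : p ∣ Nat.card N := by
      rw [Sylow.card_eq_index_normalizer (default : Sylow q N)] at h
      exact h.trans (Subgroup.index_dvd_card _)
    obtain ⟨n, hn⟩ := isPGroup_iff_card_dvd_pow.1 hN
    have h2 : p ∣ m ^ n := h1.trans hn
    have h3 := hp.dvd_of_dvd_pow h2
    exact hp.one_lt.ne' (Nat.eq_one_of_dvd_coprimes hm h3 dvd_rfl)
  obtain ⟨S, hS⟩ := hRp.nonempty_fixed_point_of_prime_not_dvd_card (Sylow q N) hcard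
  refine ⟨S, ?_⟩
  rw [Subgroup.le_normalizer_iff]
  rintro r hr _ ⟨s, hs, rfl⟩
  have h1 : φ ⟨r, hr⟩ • S = S := hS ⟨r, hr⟩
  have h2 : φ ⟨r, hr⟩ s ∈ φ ⟨r, hr⟩ • S := by
    change _ ∈ φ ⟨r, hr⟩ • (S : Subgroup N)
    exact Subgroup.smul_mem_pointwise_smul s (φ ⟨r, hr⟩) (S : Subgroup N) hs
  rw [h1] at h2
  exact ⟨_, h2, by simp [φ]⟩

end WeaklySubnormalFacts


open scoped commutatorElement in
theorem ws_irreducible {G : Type*} [Group G] [Finite G] {p : ℕ} (hp : p.Prime) {R : Subgroup G}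
    (hRp : IsPGroup p R) (hw : WeaklySubnormal R) {m : ℕ} (hm : m.Coprime p) {q : ℕ}
    (hq : q.Prime) {Q : Subgroup G} (hQn : Q.Normal) (hQq : IsPGroup q Q) (hQm : IsPGroup m Q)
    (hQR : Q ⊔ R = ⊤) :
    frattiniIn Q ≠ Q ∧
        (∀ N : Subgroup G, N ≤ Q → frattiniIn Q ≤ N →
          (∀ r ∈ R, ∀ n ∈ N, r * n * r⁻¹ ∈ N) → N = frattiniIn Q ∨ N = Q) ∧
        (∀ r ∈ R, ∀ z ∈ frattiniIn Q, r * z = z * r) := by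
  have : Fact p.Prime := ⟨hp⟩
  have hΦn : (frattiniIn Q).Normal := by
    unfold frattiniIn
    exact ConjAct.normal_of_characteristic_of_normal
  have hΦQ : frattiniIn Q ≤ Q := Subgroup.map_subtype_le _
  have hQb : Nontrivial Q := by
    rw [Subgroup.nontrivial_iff_ne_bot]
    rintro rfl
    rw [bot_sup_eq] at hQR
    exact ws_not_pgroup hp hw hRp le_rfl hQR
  have hΦne : frattiniIn Q ≠ Q := by
    intro h
    have h1 : frattini Q = ⊤ := by
      rw [eq_top_iff]
      intro x _
      have hx : (x : G) ∈ frattiniIn Q := h.ge x.2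
      obtain ⟨y, hy, hyx⟩ := hx
      rwa [← Subtype.ext hyx]
    obtain ⟨C, hC, -⟩ := (eq_top_or_exists_le_coatom (⊥ : Subgroup Q)).resolve_left bot_ne_top
    exact hC.1 (top_le_iff.1 (h1 ▸ frattini_le_coatom hC))
  have hdis := IsPGroup.disjoint_of_coprime hQm hRp hm
  -- R centralizes proper invariant subgroups of Q
  have hcent : ∀ X : Subgroup G, X ≤ Q → X ≠ Q → R ≤ Subgroup.normalizer (X : Set G) →
      ∀ x ∈ X, ∀ r ∈ R, x * r = r * x := by
    intro X hXQ hne hRX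
    refine ws_commute hRp hw (hQm.to_le hXQ) hm hRX fun htop => hne ?_
    have hXn : X.Normal := by
      rw [← Subgroup.normalizer_eq_top_iff, eq_top_iff, ← htop]
      exact sup_le Subgroup.le_normalizer hRX
    refine le_antisymm hXQ fun x hx => ?_
    have hx' : x ∈ X ⊔ R := htop ▸ Subgroup.mem_top x
    obtain ⟨y, hy, r, hr, rfl⟩ := Subgroup.mem_sup_of_normal_left.1 hx'
    have hrQ : r ∈ Q := by simpa using Q.mul_mem (Q.inv_mem (hXQ hy)) hx
    have := Subgroup.disjoint_def.1 hdis hrQ hr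
    simpa [this] using hy
  refine ⟨hΦne, ?_, fun r hr z hz => (hcent _ hΦQ hΦne Subgroup.le_normalizer_of_normal z hz r hr).symm⟩
  intro N hNQ hΦN hRN
  by_contra! hcon
  obtain ⟨hN1, hN2⟩ := hcon
  have hRN' : R ≤ Subgroup.normalizer (N : Set G) := Subgroup.le_normalizer_iff.2 hRN
  have hcomm := commutator_le_frattini_pgroup hq hQq
  have hNn : N.Normal := by
    rw [← Subgroup.normalizer_eq_top_iff, eq_top_iff, ← hQR]
    refine sup_le ?_ hRN'
    rw [Subgroup.le_normalizer_iff]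
    intro g hg n hn
    have h1 : g * n * g⁻¹ * n⁻¹ ∈ N := by
      refine hΦN ⟨⁅(⟨g, hg⟩ : Q), (⟨n, hNQ hn⟩ : Q)⁆, hcomm ?_, ?_⟩
      · exact Subgroup.commutator_mem_commutator (Subgroup.mem_top _) (Subgroup.mem_top _)
      · simp [commutatorElement_def]
    simpa using N.mul_mem h1 hn
  have hNc := ws_central hw hNn (hcent N hNQ hN2 hRN')
  refine hN1 (le_antisymm (fun z hz => ?_) hΦN)
  have hidx : ∃ k, Q.index = p ^ k := by
    have : IsPGroup p (G ⧸ Q) := by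
      refine hRp.of_surjective ((QuotientGroup.mk' Q).comp R.subtype) fun y => ?_
      obtain ⟨g, rfl⟩ := QuotientGroup.mk'_surjective Q y
      have hg : g ∈ R ⊔ Q := sup_comm Q R ▸ hQR ▸ Subgroup.mem_top g
      obtain ⟨n, hn, x, hx, rfl⟩ := Subgroup.mem_sup_of_normal_right.1 hg
      refine ⟨⟨n, hn⟩, ?_⟩
      simp [hx]
    exact IsPGroup.iff_card.1 this
  obtain ⟨k, hk⟩ := hidx
  have hA : IsPGroup m (Abelianization Q) := hQm.of_surjective Abelianization.of
    (QuotientGroup.mk'_surjective _)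
  have hkey : ∀ (k : ℕ) (g₀ : G), g₀⁻¹ * z ^ k * g₀ ∈ Q → g₀⁻¹ * z ^ k * g₀ = z ^ k := by
    intro k g _
    have := Subgroup.mem_center_iff.1 (Subgroup.pow_mem _ (hNc hz) k) g
    rw [mul_assoc, ← this]; simp
  have htr := MonoidHom.transfer_eq_pow (Abelianization.of : Q →* Abelianization Q) z hkey
  rw [ws_hom_trivial hRp hw hA hm] at htr
  have h1 : (⟨z ^ Q.index, MonoidHom.transfer_eq_pow_aux z hkey⟩ : Q) ∈ commutator Q :=
    (QuotientGroup.eq_one_iff _).1 htr.symm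
  have h2 : z ^ p ^ k ∈ frattiniIn Q := ⟨_, hcomm h1, by simp [hk]⟩
  obtain ⟨j, hj⟩ := hQm ⟨z, hNQ hz⟩
  have h3 : z ^ m ^ j = 1 := by simpa using congrArg Subtype.val hj
  exact mem_of_pow_mem_coprime (hm.pow j k) (h3 ▸ Subgroup.one_mem _) h2

theorem ws_iv {G : Type*} [Group G] [Finite G] {p : ℕ} (hp : p.Prime) {R : Subgroup G}
    (hRp : IsPGroup p R) (hw : WeaklySubnormal R) :
    (pPrimeCore p G ≤ Subgroup.center G ⊓ frattini G ∨
      ∃ q : ℕ, q.Prime ∧ ∃ Q : Subgroup G, Q.Normal ∧ IsPGroup q Q ∧ Q ⊔ R = ⊤ ∧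
        frattiniIn Q ≠ Q ∧
        (∀ N : Subgroup G, N ≤ Q → frattiniIn Q ≤ N →
          (∀ r ∈ R, ∀ n ∈ N, r * n * r⁻¹ ∈ N) → N = frattiniIn Q ∨ N = Q) ∧
        (∀ r ∈ R, ∀ z ∈ frattiniIn Q, r * z = z * r)) := by
  obtain ⟨m, hm, hN⟩ := pPrimeCore_isPGroup (G := G) hp
  set N := pPrimeCore p G with hNdef
  have hNn : N.Normal := pPrimeCore_normal p G
  by_cases htop : N ⊔ R = ⊤
  swap
  · left
    have hc := ws_central hw hNn (ws_commute hRp hw hN hm Subgroup.le_normalizer_of_normal htop)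
    exact le_inf hc (ws_central_le_frattini hRp hw hN hm hc)
  right
  by_cases hex : ∃ q : ℕ, q.Prime ∧ ∃ S : Sylow q N, R ≤ Subgroup.normalizer
      (((S : Subgroup N).map N.subtype : Subgroup G) : Set G) ∧
        ((S : Subgroup N).map N.subtype : Subgroup G) ⊔ R = ⊤
  · obtain ⟨q, hq, S, hS1, hS2⟩ := hex
    have hQn : ((S : Subgroup N).map N.subtype : Subgroup G).Normal := by
      rw [← Subgroup.normalizer_eq_top_iff, eq_top_iff]
      exact hS2.ge.trans (sup_le Subgroup.le_normalizer hS1)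
    have hQq := S.isPGroup'.map N.subtype
    exact ⟨q, hq, _, hQn, hQq, hS2, ws_irreducible hp hRp hw hm hq hQn hQq
      (hN.to_le (Subgroup.map_subtype_le _)) hS2⟩
  · exfalso
    have h1 : (Subgroup.centralizer (R : Set G)).subgroupOf N = ⊤ := by
      refine eq_top_of_sylow_le _ fun q hq => ?_
      obtain ⟨S, hS⟩ := exists_invariant_sylow hp hRp hN hm q hq
      refine ⟨S, fun s hs => ?_⟩
      rw [Subgroup.mem_subgroupOf, Subgroup.mem_centralizer_iff]
      intro r hr
      exact (ws_commute hRp hw (hN.to_le (Subgroup.map_subtype_le (S : Subgroup N))) hm hS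
        (fun h => hex ⟨q, hq, S, hS, h⟩) s ⟨s, hs, rfl⟩ r hr).symm
    rw [Subgroup.subgroupOf_eq_top] at h1
    refine hw.1 (normalIn_iff.2 ⟨le_top, ?_⟩).subnormal
    rw [← htop]
    refine sup_le (h1.trans ?_) Subgroup.le_normalizer
    rw [Subgroup.le_normalizer_iff]
    intro c hc r hr
    rw [← Subgroup.mem_centralizer_iff.1 hc r hr]
    simpa using hr

theorem ws_v {G : Type*} [Group G] [Finite G] {p : ℕ} (hp : p.Prime) {R M : Subgroup G}
    (hRp : IsPGroup p R) (hw : WeaklySubnormal R) (hM : IsCoatom M) (hRM : R ≤ M)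
    (h : pPrimeCore p G ≤ Subgroup.center G ⊓ frattini G) : fitting G ≤ M := by
  refine sSup_le fun H hH => ?_
  obtain ⟨hHn, hHnil⟩ := hH
  rw [← Subgroup.subgroupOf_eq_top]
  refine eq_top_of_sylow_le _ fun q hq => ?_
  have : Fact q.Prime := ⟨hq⟩
  have htf := (Group.isNilpotent_of_finite_tfae (G := H)).out 0 3
  have hS := htf.1 hHnil q inferInstance default
  set S : Sylow q H := default
  have hSc : (S : Subgroup H).Characteristic := S.characteristic_of_normal hS
  have hXn : ((S : Subgroup H).map H.subtype).Normal :=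
    ConjAct.normal_of_characteristic_of_normal
  have hXq := S.isPGroup'.map H.subtype
  set X := (S : Subgroup H).map H.subtype with hX
  refine ⟨S, fun s hs => ?_⟩
  rw [Subgroup.mem_subgroupOf]
  have hsX : (s : G) ∈ X := ⟨s, hs, rfl⟩
  suffices hle : X ≤ M from hle hsX
  by_cases hqp : q = p
  · subst hqp
    have hne := ws_not_pgroup hp hw (hXq.to_sup_of_normal_left hRp) le_sup_right
    obtain ⟨L, hL, hXL⟩ := (eq_top_or_exists_le_coatom (X ⊔ R)).resolve_left hne
    rw [unique_max hp hRp hw hM hL hRM (le_sup_right.trans hXL)]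
    exact le_sup_left.trans hXL
  · have hle : X ≤ pPrimeCore p G := by
      refine le_sSup ⟨hXn, ?_⟩
      obtain ⟨n, hn⟩ := IsPGroup.iff_card.1 hXq
      rw [hn]
      exact ((Nat.coprime_primes hq hp).2 hqp).pow_left n
    exact hle.trans (h.trans (inf_le_right.trans (frattini_le_coatom hM)))


/-- **Lemma (basic properties of weakly subnormal `p`-subgroups).** -/
theorem statement6 {G : Type*} [Group G] [Finite G] {p : ℕ} (hp : p.Prime)
    (hdvd : p ∣ Nat.card G) (R : Subgroup G) (hRp : IsPGroup p R)
    (hwsn : WeaklySubnormal R) :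
    -- (i) G is the normal closure of R
    Subgroup.normalClosure (R : Set G) = ⊤ ∧
    -- (ii) R is contained in a unique maximal subgroup M, and R ≤ O_p(M);
    -- (v) if the first case of (iv) holds then F(G) ≤ M
    (∃ M : Subgroup G, IsCoatom M ∧ R ≤ (pCore p M).map M.subtype ∧
      (∀ M' : Subgroup G, IsCoatom M' → R ≤ M' → M' = M) ∧
      (pPrimeCore p G ≤ Subgroup.center G ⊓ frattini G → fitting G ≤ M)) ∧
    -- (iii) R is subnormal in RΦ(G) and O_{p'}(G) ∩ Φ(G) ≤ Z(G)
    Subnormal R (R ⊔ frattini G) ∧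
    pPrimeCore p G ⊓ frattini G ≤ Subgroup.center G ∧
    -- (iv)
    (pPrimeCore p G ≤ Subgroup.center G ⊓ frattini G ∨
      ∃ q : ℕ, q.Prime ∧ ∃ Q : Subgroup G, Q.Normal ∧ IsPGroup q Q ∧ Q ⊔ R = ⊤ ∧
        frattiniIn Q ≠ Q ∧
        (∀ N : Subgroup G, N ≤ Q → frattiniIn Q ≤ N →
          (∀ r ∈ R, ∀ n ∈ N, r * n * r⁻¹ ∈ N) → N = frattiniIn Q ∨ N = Q) ∧
        (∀ r ∈ R, ∀ z ∈ frattiniIn Q, r * z = z * r)) := by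
  have hR_ne : R ≠ ⊤ := ws_not_pgroup hp hwsn hRp le_rfl
  have hΦ : R ⊔ frattini G ≠ ⊤ := fun h => hR_ne (frattini_nongenerating h)
  refine ⟨ws_top_of_normal hwsn Subgroup.normalClosure_normal Subgroup.subset_normalClosure, ?_,
    hwsn.2 _ le_sup_left hΦ, ?_, ws_iv hp hRp hwsn⟩
  · obtain ⟨M, hM, hRM⟩ := (eq_top_or_exists_le_coatom R).resolve_left hR_ne
    refine ⟨M, hM, ?_, fun M' hM' hRM' => unique_max hp hRp hwsn hM' hM hRM' hRM,
      ws_v hp hRp hwsn hM hRM⟩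
    obtain ⟨P, h1, h2, h3⟩ := psub_of_subnormal hRp (hwsn.2 M hRM hM.1)
    intro r hr
    refine ⟨⟨r, hRM hr⟩, ?_, rfl⟩
    have hmem : P.subgroupOf M ∈ {H : Subgroup M | H.Normal ∧ IsPGroup p H} :=
      ⟨(Subgroup.normal_subgroupOf_iff h2.1).2 fun h k hh hk => h2.2 k hk h hh,
        h3.comap_subtype⟩
    exact (le_sSup hmem : _ ≤ pCore p M) (Subgroup.mem_subgroupOf.2 (h1 hr))
  · obtain ⟨m, hm, hN⟩ := pPrimeCore_isPGroup (G := G) hp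
    have hn : (pPrimeCore p G ⊓ frattini G).Normal := inferInstance
    refine ws_central hwsn hn (ws_commute hRp hwsn (hN.to_le inf_le_left) hm
      Subgroup.le_normalizer_of_normal fun h => hΦ ?_)
    rw [eq_top_iff, ← h]
    exact sup_le (inf_le_right.trans le_sup_right) le_sup_left
end
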